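/- Let n ≥ 1 and 1 < p < 2. There exists a constant C > 0, depending only on n and p, such that the following holds. Let u : ℝⁿ×[0,1] → ℝ be smooth with compact support (in particular u vanishes for |x| large), with u(x,0) = 0 for all x ∈ ℝⁿ, and set f := ∂_t u − Δu on ℝⁿ×(0,1). Then ‖∂_t u‖_{L^p(ℝⁿ×(0,1))} ≤ C ‖f‖_{L^p(ℝⁿ×(0,1))}, and consequently also ‖Δu‖_{L^p(ℝⁿ×(0,1))} ≤ (1+C) ‖f‖_{L^p(ℝⁿ×(0,1))}. -/

import Mathlib

open MeasureTheory Metric ENNReal Set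

/-- The parabolic cube `Q_r(x₀,t₀) = B_r(x₀) × (t₀ − r²/2, t₀ + r²/2]` in `ℝⁿ × ℝ`. -/
noncomputable def pCube {n : ℕ} (r : ℝ) (c : EuclideanSpace ℝ (Fin n) × ℝ) :
    Set (EuclideanSpace ℝ (Fin n) × ℝ) :=
  (ball c.1 r) ×ˢ Set.Ioc (c.2 - r ^ 2 / 2) (c.2 + r ^ 2 / 2)

/-- Spatial partial derivative `∂_{x_i} u` of `u : ℝⁿ × ℝ → ℝ`. -/
noncomputable def pdx {n : ℕ} (i : Fin n) (u : EuclideanSpace ℝ (Fin n) × ℝ → ℝ) :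
    EuclideanSpace ℝ (Fin n) × ℝ → ℝ :=
  fun z => fderiv ℝ u z (EuclideanSpace.single i 1, 0)

/-- Time derivative `∂_t u` of `u : ℝⁿ × ℝ → ℝ`. -/
noncomputable def pdt {n : ℕ} (u : EuclideanSpace ℝ (Fin n) × ℝ → ℝ) :
    EuclideanSpace ℝ (Fin n) × ℝ → ℝ :=
  fun z => fderiv ℝ u z (0, 1)

/-- Entry `(i,j)` of the spatial Hessian `D²u`, i.e. `∂_{x_j} ∂_{x_i} u`. -/
noncomputable def hessEntryP {n : ℕ} (u : EuclideanSpace ℝ (Fin n) × ℝ → ℝ)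
    (i j : Fin n) : EuclideanSpace ℝ (Fin n) × ℝ → ℝ :=
  pdx j (pdx i u)

/-- Squared Frobenius norm `|D²u(z)|²` of the spatial Hessian. -/
noncomputable def hessFrobSqP {n : ℕ} (u : EuclideanSpace ℝ (Fin n) × ℝ → ℝ)
    (z : EuclideanSpace ℝ (Fin n) × ℝ) : ℝ :=
  ∑ i, ∑ j, (hessEntryP u i j z) ^ 2

/-- Spatial Laplacian `Δu = tr D²u`. -/
noncomputable def lapP {n : ℕ} (u : EuclideanSpace ℝ (Fin n) × ℝ → ℝ)
    (z : EuclideanSpace ℝ (Fin n) × ℝ) : ℝ :=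
  ∑ i, hessEntryP u i i z

section Plancherel

open FourierTransform SchwartzMap

variable {V : Type*} [NormedAddCommGroup V] [InnerProductSpace ℝ V] [FiniteDimensional ℝ V]
  [MeasurableSpace V] [BorelSpace V]

theorem fourier_toLp_ae_eq {h : V → ℂ} (h1 : Integrable h) (h2 : MemLp h 2) :
    (𝓕 (h2.toLp h) : Lp ℂ 2 (volume : Measure V)) =ᵐ[volume] 𝓕 h := by
  have hloc : LocallyIntegrable (𝓕 (h2.toLp h) : Lp ℂ 2 (volume : Measure V)) volume :=
    (Lp.memLp _).locallyIntegrable (by norm_num)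
  have hcont : Continuous (𝓕 h) :=
    VectorFourier.fourierIntegral_continuous Real.continuous_fourierChar
      (by exact continuous_inner) h1
  refine ae_eq_of_integral_contDiff_smul_eq hloc hcont.locallyIntegrable fun g hg hgs => ?_
  let φ : 𝓢(V, ℂ) := HasCompactSupport.toSchwartzMap (f := fun x => (g x : ℂ))
    (hgs.comp_left (g := fun r : ℝ => (r : ℂ)) (by simp))
    (Complex.ofRealCLM.contDiff.comp hg)
  have hφ : ∀ x, φ x = (g x : ℂ) := fun x => rfl
  have e1 := congrArg (fun T => T φ) (Lp.fourier_toTemperedDistribution_eq (h2.toLp h))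
  simp only [TemperedDistribution.fourier_apply, Lp.toTemperedDistribution_apply] at e1
  have e2 : ∫ x, (𝓕 φ : 𝓢(V, ℂ)) x • (h2.toLp h) x = ∫ x, (𝓕 φ : 𝓢(V, ℂ)) x • h x := by
    refine integral_congr_ae ?_
    filter_upwards [h2.coeFn_toLp] with x hx
    rw [hx]
  have e3 : ∫ ξ, (𝓕 (φ : V → ℂ)) ξ • h ξ = ∫ x, φ x • 𝓕 h x := by
    have := VectorFourier.integral_fourierIntegral_smul_eq_flip (L := innerₗ V) (μ := volume)
      (ν := volume) (f := φ) (g := h)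
      Real.continuous_fourierChar (by exact continuous_inner) φ.integrable h1
    rw [flip_innerₗ] at this
    exact this
  rw [e2, SchwartzMap.fourier_coe, e3] at e1
  simp only [hφ, smul_eq_mul] at e1
  simpa [Complex.real_smul] using e1.symm

theorem lintegral_enorm_fourier_sq {h : V → ℂ} (h1 : Integrable h) (h2 : MemLp h 2) :
    ∫⁻ ξ, ‖𝓕 h ξ‖ₑ ^ 2 = ∫⁻ x, ‖h x‖ₑ ^ 2 := by
  have key : ∀ k : V → ℂ, eLpNorm k 2 volume ^ 2 = ∫⁻ x, ‖k x‖ₑ ^ 2 := by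
    intro k
    have := eLpNorm_nnreal_pow_eq_lintegral (f := k) (μ := (volume : Measure V))
      (p := 2) (by norm_num)
    simpa using this
  have hn := Lp.norm_fourier_eq (h2.toLp h)
  rw [← key, ← key, ← eLpNorm_congr_ae (fourier_toLp_ae_eq h1 h2),
    ← eLpNorm_congr_ae h2.coeFn_toLp, ← Lp.enorm_def, ← Lp.enorm_def]
  rw [← ofReal_norm, ← ofReal_norm, hn]

end Plancherel

section Interpolation

theorem lintegral_Ioc_rpow {a r : ℝ} (ha : 0 ≤ a) (hr : -1 < r) :
    ∫⁻ t in Ioc 0 a, ENNReal.ofReal (t ^ r) = ENNReal.ofReal (a ^ (r + 1) / (r + 1)) := by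
  have hi : IntervalIntegrable (fun t : ℝ => t ^ r) volume 0 a :=
    intervalIntegral.intervalIntegrable_rpow' hr
  rw [← ofReal_integral_eq_lintegral_ofReal, ← intervalIntegral.integral_of_le ha,
    integral_rpow (Or.inl hr), Real.zero_rpow (by linarith), sub_zero]
  · exact (intervalIntegrable_iff_integrableOn_Ioc_of_le ha).1 hi
  · filter_upwards [ae_restrict_mem measurableSet_Ioc] with t ht
    exact Real.rpow_nonneg ht.1.le _

theorem lintegral_Ioi_rpow {a r : ℝ} (ha : 0 < a) (hr : r < -1) :
    ∫⁻ t in Ioi a, ENNReal.ofReal (t ^ r) = ENNReal.ofReal (a ^ (r + 1) / (-(r + 1))) := by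
  rw [← ofReal_integral_eq_lintegral_ofReal, integral_Ioi_rpow_of_lt hr ha]
  · congr 1
    rw [div_neg, neg_div]
  · exact integrableOn_Ioi_rpow_of_lt hr ha
  · filter_upwards [ae_restrict_mem measurableSet_Ioi] with t ht
    exact Real.rpow_nonneg (ha.trans ht).le _

theorem lintegral_rpow_mul_min_sq_le {a p : ℝ} (ha : 0 ≤ a) (hp₁ : 1 < p) (hp₂ : p < 2) :
    ∫⁻ t in Ioi (0 : ℝ), ENNReal.ofReal (t ^ (p - 3)) * ENNReal.ofReal (min a t ^ 2) ≤
      ENNReal.ofReal (1 / p + 1 / (2 - p)) * ENNReal.ofReal (a ^ p) := by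
  rcases ha.eq_or_lt with rfl | ha'
  · rw [setLIntegral_congr_fun (g := fun _ => 0) measurableSet_Ioi]
    · simp
    · intro t ht
      have : (0 : ℝ) < t := ht
      simp [min_eq_left this.le]
  rw [← Ioc_union_Ioi_eq_Ioi ha, lintegral_union measurableSet_Ioi Ioc_disjoint_Ioi_same]
  have h1 : ∫⁻ t in Ioc 0 a, ENNReal.ofReal (t ^ (p - 3)) * ENNReal.ofReal (min a t ^ 2) =
      ENNReal.ofReal (a ^ p / p) := by
    rw [setLIntegral_congr_fun (g := fun t => ENNReal.ofReal (t ^ (p - 1))) measurableSet_Ioc,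
      lintegral_Ioc_rpow ha (by linarith)]
    · simp
    · intro t ht
      dsimp only
      rw [min_eq_right ht.2, ← ENNReal.ofReal_mul (Real.rpow_nonneg ht.1.le _),
        ← Real.rpow_natCast, ← Real.rpow_add ht.1]
      congr 2
      push_cast
      ring
  have h2 : ∫⁻ t in Ioi a, ENNReal.ofReal (t ^ (p - 3)) * ENNReal.ofReal (min a t ^ 2) =
      ENNReal.ofReal (a ^ p / (2 - p)) := by
    rw [setLIntegral_congr_fun
      (g := fun t => ENNReal.ofReal (t ^ (p - 3)) * ENNReal.ofReal (a ^ 2)) measurableSet_Ioi,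
      lintegral_mul_const _ (by fun_prop), lintegral_Ioi_rpow ha' (by linarith),
      ← ENNReal.ofReal_mul]
    · congr 1
      have : a ^ p = a ^ (p - 3 + 1) * a ^ 2 := by
        rw [← Real.rpow_natCast, ← Real.rpow_add ha']
        congr 1
        push_cast
        ring
      rw [this]
      have : -(p - 3 + 1) = 2 - p := by ring
      rw [this]
      ring
    · have : 0 < -(p - 3 + 1) := by linarith
      positivity
    · intro t ht
      dsimp only
      rw [min_eq_left (le_of_lt ht)]
  have h3 : 0 < 2 - p := by linarith
  rw [h1, h2, ← ENNReal.ofReal_add (by positivity) (by positivity),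
    ← ENNReal.ofReal_mul (by positivity)]
  apply le_of_eq
  congr 1
  ring

theorem lintegral_rpow_mul_max_sub_le {a p : ℝ} (ha : 0 ≤ a) (hp₁ : 1 < p) :
    ∫⁻ t in Ioi (0 : ℝ), ENNReal.ofReal (t ^ (p - 2)) * ENNReal.ofReal (max (a - t) 0) ≤
      ENNReal.ofReal (1 / (p - 1)) * ENNReal.ofReal (a ^ p) := by
  rcases ha.eq_or_lt with rfl | ha'
  · rw [setLIntegral_congr_fun (g := fun _ => 0) measurableSet_Ioi]
    · simp
    · intro t ht
      have : (0 : ℝ) < t := ht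
      simp [this.le]
  have hp : 0 < p - 1 := by linarith
  rw [← Ioc_union_Ioi_eq_Ioi ha, lintegral_union measurableSet_Ioi Ioc_disjoint_Ioi_same]
  have h2 : ∫⁻ t in Ioi a, ENNReal.ofReal (t ^ (p - 2)) * ENNReal.ofReal (max (a - t) 0) = 0 := by
    rw [setLIntegral_congr_fun (g := fun _ => 0) measurableSet_Ioi]
    · simp
    · intro t ht
      have : a < t := ht
      simp [this.le]
  rw [h2, add_zero]
  calc _ ≤ ∫⁻ t in Ioc 0 a, ENNReal.ofReal (t ^ (p - 2)) * ENNReal.ofReal a := by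
        refine setLIntegral_mono (by fun_prop) fun t ht => ?_
        gcongr
        exact max_le (by linarith [ht.1]) ha
    _ = ENNReal.ofReal (1 / (p - 1)) * ENNReal.ofReal (a ^ p) := by
        have h4 : p - 2 + 1 = p - 1 := by ring
        rw [lintegral_mul_const _ (by fun_prop), lintegral_Ioc_rpow ha (by linarith), h4,
          ← ENNReal.ofReal_mul (by positivity), ← ENNReal.ofReal_mul (by positivity)]
        congr 1
        have : a ^ p = a ^ (p - 1) * a := by
          rw [← Real.rpow_add_one ha'.ne']
          congr 1
          ring
        rw [this]
        ring

/-- Marcinkiewicz interpolation between weak type `(1,1)` and weak type `(2,2)`, for one function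
`f` split at height `t` into its truncation and its excess. -/
theorem lintegral_rpow_le_of_distribution_le {X : Type*} [MeasurableSpace X] {μ : Measure X}
    [SFinite μ] {f F : X → ℝ} (hf : Measurable f) (hF : AEMeasurable F μ) (hF0 : ∀ x, 0 ≤ F x)
    {A B : ℝ≥0∞} {p : ℝ} (hp₁ : 1 < p) (hp₂ : p < 2)
    (h : ∀ t : ℝ, 0 < t → μ {x | 2 * t < F x} ≤
      A * ENNReal.ofReal (t ^ (-2 : ℝ)) * ∫⁻ x, ENNReal.ofReal (min |f x| t ^ 2) ∂μ +
      B * ENNReal.ofReal (t ^ (-1 : ℝ)) * ∫⁻ x, ENNReal.ofReal (max (|f x| - t) 0) ∂μ) :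
    ∫⁻ x, ENNReal.ofReal (F x ^ p) ∂μ ≤
      ENNReal.ofReal (2 ^ p) * (ENNReal.ofReal p * (A * ENNReal.ofReal (1 / p + 1 / (2 - p)) +
        B * ENNReal.ofReal (1 / (p - 1)))) * ∫⁻ x, ENNReal.ofReal (|f x| ^ p) ∂μ := by
  have hp0 : 0 < p := by linarith
  have e1 : ∀ x, ENNReal.ofReal (F x ^ p) =
      ENNReal.ofReal (2 ^ p) * ENNReal.ofReal ((F x / 2) ^ p) := by
    intro x
    rw [← ENNReal.ofReal_mul (by positivity), ← Real.mul_rpow (by norm_num)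
      (by have := hF0 x; positivity)]
    congr 2
    ring
  simp_rw [e1]
  rw [lintegral_const_mul' _ _ ENNReal.ofReal_ne_top, mul_assoc]
  gcongr
  rw [lintegral_rpow_eq_lintegral_meas_lt_mul μ
    (Filter.Eventually.of_forall fun x => by have := hF0 x; positivity)
    (hF.div_const 2) hp0, mul_assoc]
  gcongr
  have m1 : Measurable fun q : ℝ × X =>
      ENNReal.ofReal (q.1 ^ (p - 3)) * ENNReal.ofReal (min |f q.2| q.1 ^ 2) := by
    fun_prop
  have m2 : Measurable fun q : ℝ × X =>
      ENNReal.ofReal (q.1 ^ (p - 2)) * ENNReal.ofReal (max (|f q.2| - q.1) 0) := by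
    fun_prop
  calc ∫⁻ t in Ioi (0 : ℝ), μ {x | t < F x / 2} * ENNReal.ofReal (t ^ (p - 1))
      ≤ ∫⁻ t in Ioi (0 : ℝ),
        (A * ∫⁻ x, ENNReal.ofReal (t ^ (p - 3)) * ENNReal.ofReal (min |f x| t ^ 2) ∂μ +
        B * ∫⁻ x, ENNReal.ofReal (t ^ (p - 2)) * ENNReal.ofReal (max (|f x| - t) 0) ∂μ) := by
        refine setLIntegral_mono' measurableSet_Ioi fun t ht => ?_
        have ht' : 0 < t := ht
        have hset : {x | t < F x / 2} = {x | 2 * t < F x} := by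
          ext x
          simp only [mem_ofPred_eq]
          constructor <;> intro _ <;> linarith
        rw [hset, lintegral_const_mul' _ _ ENNReal.ofReal_ne_top,
          lintegral_const_mul' _ _ ENNReal.ofReal_ne_top]
        refine (mul_le_mul_left (h t ht') _).trans (le_of_eq ?_)
        have r1 : ENNReal.ofReal (t ^ (p - 3)) =
            ENNReal.ofReal (t ^ (-2 : ℝ)) * ENNReal.ofReal (t ^ (p - 1)) := by
          rw [← ENNReal.ofReal_mul (by positivity), ← Real.rpow_add ht']
          congr 2
          ring
        have r2 : ENNReal.ofReal (t ^ (p - 2)) =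
            ENNReal.ofReal (t ^ (-1 : ℝ)) * ENNReal.ofReal (t ^ (p - 1)) := by
          rw [← ENNReal.ofReal_mul (by positivity), ← Real.rpow_add ht']
          congr 2
          ring
        rw [r1, r2]
        ring
    _ = A * ∫⁻ x, (∫⁻ t in Ioi (0 : ℝ),
          ENNReal.ofReal (t ^ (p - 3)) * ENNReal.ofReal (min |f x| t ^ 2)) ∂μ +
        B * ∫⁻ x, (∫⁻ t in Ioi (0 : ℝ),
          ENNReal.ofReal (t ^ (p - 2)) * ENNReal.ofReal (max (|f x| - t) 0)) ∂μ := by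
        rw [lintegral_add_left (m1.lintegral_prod_right'.const_mul A),
          lintegral_const_mul _ m1.lintegral_prod_right',
          lintegral_const_mul _ m2.lintegral_prod_right']
        congr 2
        · exact lintegral_lintegral_swap m1.aemeasurable
        · exact lintegral_lintegral_swap m2.aemeasurable
    _ ≤ A * ∫⁻ x, ENNReal.ofReal (1 / p + 1 / (2 - p)) * ENNReal.ofReal (|f x| ^ p) ∂μ +
        B * ∫⁻ x, ENNReal.ofReal (1 / (p - 1)) * ENNReal.ofReal (|f x| ^ p) ∂μ := by
        gcongr with x x
        · exact lintegral_rpow_mul_min_sq_le (abs_nonneg _) hp₁ hp₂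
        · exact lintegral_rpow_mul_max_sub_le (abs_nonneg _) hp₁
    _ = _ := by
        rw [lintegral_const_mul' _ _ ENNReal.ofReal_ne_top,
          lintegral_const_mul' _ _ ENNReal.ofReal_ne_top]
        ring

end Interpolation

section CalderonZygmund

/-- A nested sequence of countable partitions of a measure space into cells `{x | label j x = i}`
of common measure `vol j`, whose measures decrease at most by the factor `D` per generation. -/
structure DyadicSystem {X I : Type*} [MeasurableSpace X] (μ : Measure X) (label : ℕ → X → I)
    (vol : ℕ → ℝ) (D : ℝ) : Prop where
  measurableSet_cell : ∀ j i, MeasurableSet {x | label j x = i}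
  nested : ∀ j x y, label (j + 1) x = label (j + 1) y → label j x = label j y
  vol_pos : ∀ j, 0 < vol j
  measure_cell : ∀ j i, μ {x | label j x = i} = ENNReal.ofReal (vol j)
  vol_le : ∀ j, vol j ≤ D * vol (j + 1)
  one_le : 1 ≤ D

/-- Cell `i` of generation `j` if it is a maximal cell on which the mean of `|f|` exceeds `t`,
and the empty set otherwise. -/
def stoppedCell {X I : Type*} [MeasurableSpace X] (μ : Measure X) (label : ℕ → X → I)
    (vol : ℕ → ℝ) (f : X → ℝ) (t : ℝ) (q : ℕ × I) : Set X :=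
  {x | label q.1 x = q.2 ∧
    ENNReal.ofReal (t * vol q.1) < ∫⁻ y in {y | label q.1 y = label q.1 x}, ‖f y‖ₑ ∂μ ∧
    ∀ k < q.1, ∫⁻ y in {y | label k y = label k x}, ‖f y‖ₑ ∂μ ≤ ENNReal.ofReal (t * vol k)}

open Classical in
/-- The good part of the Calderón–Zygmund decomposition of `f` at height `t`. -/
noncomputable def goodPart {X I : Type*} [MeasurableSpace X] (μ : Measure X) (label : ℕ → X → I)
    (vol : ℕ → ℝ) (f : X → ℝ) (t : ℝ) (x : X) : ℝ :=
  if h : ∃ q, x ∈ stoppedCell μ label vol f t q then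
    ⨍ y in stoppedCell μ label vol f t h.choose, f y ∂μ
  else f x

variable {X I : Type*} [MeasurableSpace X] {μ : Measure X} {label : ℕ → X → I}
  {vol : ℕ → ℝ} {D : ℝ} {f : X → ℝ} {t : ℝ}

theorem DyadicSystem.label_eq_of_le (hd : DyadicSystem μ label vol D) {j k : ℕ} (hk : k ≤ j)
    {x y : X} (h : label j x = label j y) : label k x = label k y := by
  induction j, hk using Nat.le_induction with
  | base => exact h
  | succ m _ ih => exact ih (hd.nested m x y h)

theorem stoppedCell_eq_of_mem (hd : DyadicSystem μ label vol D) {q : ℕ × I} {x : X}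
    (hx : x ∈ stoppedCell μ label vol f t q) :
    stoppedCell μ label vol f t q = {y | label q.1 y = q.2} := by
  refine Subset.antisymm (fun y hy => hy.1) fun y hy => ⟨hy, ?_, ?_⟩
  · have : label q.1 y = label q.1 x := by rw [hx.1]; exact hy
    rw [this]
    exact hx.2.1
  · intro k hk
    have : label k y = label k x := hd.label_eq_of_le hk.le (by rw [hx.1]; exact hy)
    rw [this]
    exact hx.2.2 k hk

theorem measurableSet_stoppedCell (hd : DyadicSystem μ label vol D) (q : ℕ × I) :
    MeasurableSet (stoppedCell μ label vol f t q) := by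
  rcases (stoppedCell μ label vol f t q).eq_empty_or_nonempty with h | ⟨x, hx⟩
  · rw [h]
    exact MeasurableSet.empty
  · rw [stoppedCell_eq_of_mem hd hx]
    exact hd.measurableSet_cell _ _

theorem stoppedCell_index_unique {q q' : ℕ × I} {x : X}
    (hx : x ∈ stoppedCell μ label vol f t q) (hx' : x ∈ stoppedCell μ label vol f t q') :
    q = q' := by
  have h1 : q.1 = q'.1 := by
    rcases lt_trichotomy q.1 q'.1 with h | h | h
    · exact absurd (hx'.2.2 _ h) (not_le.2 hx.2.1)
    · exact h
    · exact absurd (hx.2.2 _ h) (not_le.2 hx'.2.1)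
  refine Prod.ext h1 ?_
  rw [← hx.1, ← hx'.1, h1]

theorem pairwise_disjoint_stoppedCell :
    Pairwise fun q q' : ℕ × I =>
      Disjoint (stoppedCell μ label vol f t q) (stoppedCell μ label vol f t q') :=
  fun _ _ hne => Set.disjoint_left.2 fun _ hx hx' => hne (stoppedCell_index_unique hx hx')

theorem mul_measure_stoppedCell_le (hd : DyadicSystem μ label vol D) (ht : 0 < t) (q : ℕ × I) :
    ENNReal.ofReal t * μ (stoppedCell μ label vol f t q) ≤
      ∫⁻ y in stoppedCell μ label vol f t q, ‖f y‖ₑ ∂μ := by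
  rcases (stoppedCell μ label vol f t q).eq_empty_or_nonempty with h | ⟨x, hx⟩
  · simp [h]
  · rw [stoppedCell_eq_of_mem hd hx, hd.measure_cell, ← ENNReal.ofReal_mul ht.le]
    have := hx.2.1.le
    rwa [hx.1] at this

theorem measure_stoppedCell_lt_top (hd : DyadicSystem μ label vol D) (q : ℕ × I) :
    μ (stoppedCell μ label vol f t q) < ∞ :=
  (measure_mono fun _ hx => hx.1).trans_lt
    ((hd.measure_cell q.1 q.2).trans_lt ENNReal.ofReal_lt_top)

theorem lintegral_stoppedCell_le (hd : DyadicSystem μ label vol D) (ht : 0 < t)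
    (h0 : ∫⁻ y, ‖f y‖ₑ ∂μ ≤ ENNReal.ofReal (t * vol 0)) (q : ℕ × I) :
    ∫⁻ y in stoppedCell μ label vol f t q, ‖f y‖ₑ ∂μ ≤
      ENNReal.ofReal (D * t) * μ (stoppedCell μ label vol f t q) := by
  rcases (stoppedCell μ label vol f t q).eq_empty_or_nonempty with h | ⟨x, hx⟩
  · simp [h]
  · have hD : 0 ≤ D := zero_le_one.trans hd.one_le
    obtain ⟨j, i⟩ := q
    rcases j with _ | j
    · exact absurd ((setLIntegral_le_lintegral _ _).trans h0) (not_le.2 hx.2.1)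
    · have h1 := hx.2.2 j (Nat.lt_succ_self j)
      rw [stoppedCell_eq_of_mem hd hx, hd.measure_cell, ← ENNReal.ofReal_mul (by positivity)]
      calc _ ≤ ∫⁻ y in {y | label j y = label j x}, ‖f y‖ₑ ∂μ := by
            refine lintegral_mono_set fun y hy => ?_
            exact hd.nested j y x (by rw [hx.1]; exact hy)
        _ ≤ _ := h1
        _ ≤ _ := by
            apply ENNReal.ofReal_le_ofReal
            have := mul_le_mul_of_nonneg_left (hd.vol_le j) ht.le
            linarith

theorem goodPart_of_mem {q : ℕ × I} {x : X} (hx : x ∈ stoppedCell μ label vol f t q) :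
    goodPart μ label vol f t x = ⨍ y in stoppedCell μ label vol f t q, f y ∂μ := by
  have h : ∃ q, x ∈ stoppedCell μ label vol f t q := ⟨q, hx⟩
  rw [goodPart, dif_pos h, stoppedCell_index_unique h.choose_spec hx]

theorem goodPart_of_notMem {x : X} (hx : ∀ q, x ∉ stoppedCell μ label vol f t q) :
    goodPart μ label vol f t x = f x := by
  rw [goodPart, dif_neg (by push Not; exact hx)]

theorem measurable_goodPart [Countable I] (hd : DyadicSystem μ label vol D) (hf : Measurable f) :
    Measurable (goodPart μ label vol f t) := by
  intro U hU
  have : goodPart μ label vol f t ⁻¹' U =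
      ((⋃ q, stoppedCell μ label vol f t q)ᶜ ∩ f ⁻¹' U) ∪
      ⋃ q, (stoppedCell μ label vol f t q ∩
        {_x | (⨍ y in stoppedCell μ label vol f t q, f y ∂μ) ∈ U}) := by
    ext x
    by_cases h : ∃ q, x ∈ stoppedCell μ label vol f t q
    · obtain ⟨q, hq⟩ := h
      simp only [mem_preimage, goodPart_of_mem hq, mem_union, mem_inter_iff, mem_compl_iff,
        mem_iUnion, mem_ofPred_eq]
      constructor
      · exact fun h => Or.inr ⟨q, hq, h⟩
      · rintro (h | ⟨q', hq', h⟩)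
        · exact absurd ⟨q, hq⟩ h.1
        · rwa [stoppedCell_index_unique hq hq']
    · push Not at h
      simp [goodPart_of_notMem h, h]
  rw [this]
  refine ((MeasurableSet.iUnion fun q => measurableSet_stoppedCell hd q).compl.inter
    (hf hU)).union (MeasurableSet.iUnion fun q => ?_)
  exact (measurableSet_stoppedCell hd q).inter (MeasurableSet.const _)

theorem enorm_setAverage_mul_le (S : Set X) (hS : μ S < ∞) :
    ‖⨍ y in S, f y ∂μ‖ₑ * μ S ≤ ∫⁻ y in S, ‖f y‖ₑ ∂μ := by
  rcases eq_or_ne (μ S) 0 with h | h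
  · simp [h]
  · have h1 : ‖⨍ y in S, f y ∂μ‖ₑ * μ S = ‖∫ y in S, f y ∂μ‖ₑ := by
      rw [setAverage_eq, enorm_smul, Measure.real, enorm_inv (ENNReal.toReal_ne_zero.2 ⟨h, hS.ne⟩),
        Real.enorm_eq_ofReal ENNReal.toReal_nonneg, ENNReal.ofReal_toReal hS.ne, mul_assoc,
        mul_comm _ (μ S), ← mul_assoc, ENNReal.inv_mul_cancel h hS.ne, one_mul]
    rw [h1]
    exact enorm_integral_le_lintegral_enorm _

theorem enorm_goodPart_le (hd : DyadicSystem μ label vol D) (ht : 0 < t)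
    (h0 : ∫⁻ y, ‖f y‖ₑ ∂μ ≤ ENNReal.ofReal (t * vol 0))
    (hpt : ∀ x, (∀ j, ∫⁻ y in {y | label j y = label j x}, ‖f y‖ₑ ∂μ ≤
      ENNReal.ofReal (t * vol j)) → |f x| ≤ t) (x : X) :
    ‖goodPart μ label vol f t x‖ₑ ≤ ENNReal.ofReal (D * t) := by
  by_cases h : ∃ q, x ∈ stoppedCell μ label vol f t q
  · obtain ⟨q, hq⟩ := h
    rw [goodPart_of_mem hq]
    have h1 := (enorm_setAverage_mul_le (f := f) _
      (measure_stoppedCell_lt_top (f := f) (t := t) hd q)).trans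
      (lintegral_stoppedCell_le hd ht h0 q)
    refine (ENNReal.mul_le_mul_iff_left ?_ (measure_stoppedCell_lt_top hd q).ne).1 h1
    rw [stoppedCell_eq_of_mem hd hq, hd.measure_cell]
    simpa using hd.vol_pos q.1
  · push Not at h
    rw [goodPart_of_notMem h, Real.enorm_eq_ofReal_abs]
    apply ENNReal.ofReal_le_ofReal
    have h2 : |f x| ≤ t := by
      refine hpt x fun j => ?_
      induction j using Nat.strong_induction_on with
      | _ j ih =>
        by_contra hj
        exact h (j, label j x) ⟨rfl, not_le.1 hj, ih⟩
    nlinarith [hd.one_le]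

theorem lintegral_goodPart_le [Countable I] (hd : DyadicSystem μ label vol D) :
    ∫⁻ x, ‖goodPart μ label vol f t x‖ₑ ∂μ ≤ ∫⁻ x, ‖f x‖ₑ ∂μ := by
  set Ω := ⋃ q, stoppedCell μ label vol f t q with hΩ
  have mΩ : MeasurableSet Ω := MeasurableSet.iUnion fun q => measurableSet_stoppedCell hd q
  rw [← lintegral_add_compl _ mΩ, ← lintegral_add_compl (fun x => ‖f x‖ₑ) mΩ]
  refine add_le_add ?_ (le_of_eq ?_)
  · rw [hΩ, lintegral_iUnion (fun q => measurableSet_stoppedCell hd q)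
      pairwise_disjoint_stoppedCell, lintegral_iUnion (fun q => measurableSet_stoppedCell hd q)
      pairwise_disjoint_stoppedCell]
    refine ENNReal.tsum_le_tsum fun q => ?_
    rw [setLIntegral_congr_fun (g := fun _ => ‖⨍ y in stoppedCell μ label vol f t q, f y ∂μ‖ₑ)
      (measurableSet_stoppedCell hd q) (fun x hx => by dsimp only; rw [goodPart_of_mem hx]),
      lintegral_const, Measure.restrict_apply_univ]
    exact enorm_setAverage_mul_le _ (measure_stoppedCell_lt_top hd q)
  · refine setLIntegral_congr_fun mΩ.compl fun x hx => ?_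
    rw [goodPart_of_notMem]
    intro q hq
    exact hx (mem_iUnion.2 ⟨q, hq⟩)

theorem setIntegral_sub_goodPart (hd : DyadicSystem μ label vol D) (q : ℕ × I) :
    ∫ x in stoppedCell μ label vol f t q, (f x - goodPart μ label vol f t x) ∂μ = 0 := by
  rw [setIntegral_congr_fun (g := fun x => f x - ⨍ y in stoppedCell μ label vol f t q, f y ∂μ)
    (measurableSet_stoppedCell hd q) (fun x hx => by dsimp only; rw [goodPart_of_mem hx])]
  have : IsFiniteMeasure (μ.restrict (stoppedCell μ label vol f t q)) :=
    ⟨by simpa using measure_stoppedCell_lt_top hd q⟩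
  exact integral_sub_average _ _

end CalderonZygmund

section CalderonZygmundWeakType

variable {X I : Type*} [MeasurableSpace X] {μ : Measure X} {label : ℕ → X → I}
  {vol : ℕ → ℝ} {D : ℝ} {f : X → ℝ} {t : ℝ}

theorem measure_lt_abs_le_of_lintegral_sq {g : X → ℝ} (hg : AEMeasurable g μ) {a : ℝ} (ha : 0 < a) :
    μ {z | a < |g z|} ≤ ENNReal.ofReal (a ^ (-2 : ℝ)) * ∫⁻ z, ‖g z‖ₑ ^ 2 ∂μ := by
  have h := mul_meas_ge_le_lintegral₀ (f := fun z => ‖g z‖ₑ ^ 2) (by fun_prop)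
    (ENNReal.ofReal (a ^ 2)) (μ := μ)
  have hs : μ {z | a < |g z|} ≤ μ {z | ENNReal.ofReal (a ^ 2) ≤ ‖g z‖ₑ ^ 2} := by
    refine measure_mono fun z hz => ?_
    have hz' : a < |g z| := hz
    simp only [mem_ofPred_eq]
    rw [Real.enorm_eq_ofReal_abs, ← ENNReal.ofReal_pow (abs_nonneg _)]
    gcongr
  have e : ENNReal.ofReal (a ^ (-2 : ℝ)) * ENNReal.ofReal (a ^ 2) = 1 := by
    rw [← ENNReal.ofReal_mul (by positivity), ← Real.rpow_natCast, ← Real.rpow_add ha]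
    norm_num
  calc μ {z | a < |g z|} = ENNReal.ofReal (a ^ (-2 : ℝ)) *
        (ENNReal.ofReal (a ^ 2) * μ {z | a < |g z|}) := by rw [← mul_assoc, e, one_mul]
    _ ≤ _ := by
      gcongr
      exact (mul_le_mul_right hs _).trans h

theorem measure_lt_abs_le_of_lintegral {g : X → ℝ} (hg : AEMeasurable g μ) {a : ℝ} (ha : 0 < a) :
    μ {z | a < |g z|} ≤ ENNReal.ofReal (a ^ (-1 : ℝ)) * ∫⁻ z, ‖g z‖ₑ ∂μ := by
  have h := mul_meas_ge_le_lintegral₀ (f := fun z => ‖g z‖ₑ) (by fun_prop)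
    (ENNReal.ofReal a) (μ := μ)
  have hs : μ {z | a < |g z|} ≤ μ {z | ENNReal.ofReal a ≤ ‖g z‖ₑ} := by
    refine measure_mono fun z hz => ?_
    have hz' : a < |g z| := hz
    simp only [mem_ofPred_eq]
    rw [Real.enorm_eq_ofReal_abs]
    gcongr
  have e : ENNReal.ofReal (a ^ (-1 : ℝ)) * ENNReal.ofReal a = 1 := by
    rw [← ENNReal.ofReal_mul (by positivity), Real.rpow_neg_one, inv_mul_cancel₀ ha.ne']
    simp
  calc μ {z | a < |g z|} = ENNReal.ofReal (a ^ (-1 : ℝ)) *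
        (ENNReal.ofReal a * μ {z | a < |g z|}) := by rw [← mul_assoc, e, one_mul]
    _ ≤ _ := by
      gcongr
      exact (mul_le_mul_right hs _).trans h

/-- Off the dilated cells, the image of the bad part of the Calderón–Zygmund decomposition is
controlled in `L¹` by the Hörmander condition. -/
theorem lintegral_bad_part_le [SFinite μ] [Countable I]
    {K : X → X → ℝ} (hK : Measurable (Function.uncurry K)) {M : ℝ} (hM : ∀ z w, |K z w| ≤ M)
    {B : ℝ≥0∞} (c : ℕ × I → X) (Q : ℕ × I → Set X)
    (hKQ : ∀ q : ℕ × I, ∀ w ∈ {x | label q.1 x = q.2},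
      ∫⁻ z in (Q q)ᶜ, ‖K z w - K z (c q)‖ₑ ∂μ ≤ B)
    {S : ℕ × I → Set X} (hS : ∀ q, MeasurableSet (S q))
    (hSd : Pairwise fun q q' => Disjoint (S q) (S q'))
    (hSsub : ∀ q, S q ⊆ {x | label q.1 x = q.2})
    {b : X → ℝ} (hbm : Measurable b) (hb : Integrable b μ) (hb0 : ∀ x ∉ ⋃ q, S q, b x = 0)
    (hbm0 : ∀ q, ∫ x in S q, b x ∂μ = 0) {R : Set X}
    (hR : ∀ q, (S q).Nonempty → Rᶜ ⊆ (Q q)ᶜ) :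
    ∫⁻ z in Rᶜ, ‖∫ w, K z w * b w ∂μ‖ₑ ∂μ ≤ B * ∫⁻ w, ‖b w‖ₑ ∂μ := by
  have hKz : ∀ z, Measurable (K z) := fun z => hK.comp measurable_prodMk_left
  have hInt : ∀ z, Integrable (fun w => K z w * b w) μ := fun z =>
    hb.bdd_mul (hKz z).aestronglyMeasurable (Filter.Eventually.of_forall (hM z))
  have hpt : ∀ z, ‖∫ w, K z w * b w ∂μ‖ₑ ≤
      ∑' q, ∫⁻ w in S q, ‖K z w - K z (c q)‖ₑ * ‖b w‖ₑ ∂μ := by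
    intro z
    have e1 : ∫ w, K z w * b w ∂μ = ∑' q, ∫ w in S q, K z w * b w ∂μ := by
      rw [← integral_iUnion hS hSd (hInt z).integrableOn, setIntegral_eq_integral_of_forall_compl_eq_zero]
      intro x hx
      rw [hb0 x hx, mul_zero]
    have e2 : ∀ q, ∫ w in S q, K z w * b w ∂μ =
        ∫ w in S q, (K z w - K z (c q)) * b w ∂μ := by
      intro q
      simp_rw [sub_mul]
      rw [integral_sub (hInt z).integrableOn (hb.integrableOn.const_mul _),
        integral_const_mul, hbm0 q, mul_zero, sub_zero]
    rw [e1]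
    refine (enorm_tsum_le_tsum_enorm).trans (ENNReal.tsum_le_tsum fun q => ?_)
    rw [e2]
    refine (enorm_integral_le_lintegral_enorm _).trans (le_of_eq ?_)
    simp_rw [enorm_mul]
  have hmeas : ∀ q, Measurable fun p : X × X => ‖K p.1 p.2 - K p.1 (c q)‖ₑ * ‖b p.2‖ₑ := by
    intro q
    have h1 : Measurable fun p : X × X => K p.1 p.2 := hK
    have h2 : Measurable fun p : X × X => K p.1 (c q) :=
      hK.comp (measurable_fst.prodMk measurable_const)
    exact ((h1.sub h2).enorm).mul (hbm.comp measurable_snd).enorm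
  calc ∫⁻ z in Rᶜ, ‖∫ w, K z w * b w ∂μ‖ₑ ∂μ
      ≤ ∫⁻ z in Rᶜ, ∑' q, ∫⁻ w in S q, ‖K z w - K z (c q)‖ₑ * ‖b w‖ₑ ∂μ ∂μ :=
        lintegral_mono hpt
    _ = ∑' q, ∫⁻ z in Rᶜ, ∫⁻ w in S q, ‖K z w - K z (c q)‖ₑ * ‖b w‖ₑ ∂μ ∂μ :=
        lintegral_tsum fun q => ((hmeas q).lintegral_prod_right').aemeasurable
    _ ≤ ∑' q, B * ∫⁻ w in S q, ‖b w‖ₑ ∂μ := by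
        refine ENNReal.tsum_le_tsum fun q => ?_
        rcases (S q).eq_empty_or_nonempty with h | h
        · simp [h]
        rw [lintegral_lintegral_swap (hmeas q).aemeasurable, ← lintegral_const_mul _ hbm.enorm]
        refine setLIntegral_mono' (hS q) fun w hw => ?_
        have hm : Measurable fun z => ‖K z w - K z (c q)‖ₑ :=
          ((hK.comp measurable_prodMk_right).sub (hK.comp measurable_prodMk_right)).enorm
        rw [lintegral_mul_const _ hm]
        gcongr
        exact (lintegral_mono_set (hR q h)).trans (hKQ q w (hSsub q hw))
    _ = B * ∫⁻ w in ⋃ q, S q, ‖b w‖ₑ ∂μ := by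
        rw [ENNReal.tsum_mul_left, lintegral_iUnion hS hSd]
    _ ≤ _ := by
        gcongr
        exact Measure.restrict_le_self

/-- Weak type `(1,1)` estimate at height `t` for an integral operator that is bounded on `L²` and
satisfies the Hörmander condition with respect to a dyadic system. -/
theorem measure_lt_abs_integral_kernel_le [SFinite μ] [Countable I]
    (hd : DyadicSystem μ label vol D)
    {K : X → X → ℝ} (hK : Measurable (Function.uncurry K)) {M : ℝ} (hM : ∀ z w, |K z w| ≤ M)
    (hL2 : ∀ g : X → ℝ, Measurable g → Integrable g μ → (∃ N : ℝ, ∀ x, |g x| ≤ N) →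
      ∫⁻ z, ‖∫ w, K z w * g w ∂μ‖ₑ ^ 2 ∂μ ≤ ∫⁻ z, ‖g z‖ₑ ^ 2 ∂μ)
    {B : ℝ≥0∞} (hH : ∀ q : ℕ × I, ∃ (c : X) (Q : Set X), MeasurableSet Q ∧
      μ Q ≤ B * μ {x | label q.1 x = q.2} ∧
      ∀ w ∈ {x | label q.1 x = q.2}, ∫⁻ z in Qᶜ, ‖K z w - K z c‖ₑ ∂μ ≤ B)
    (hf : Measurable f) (hfi : Integrable f μ) (ht : 0 < t)
    (h0 : ∫⁻ y, ‖f y‖ₑ ∂μ ≤ ENNReal.ofReal (t * vol 0))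
    (hpt : ∀ x, (∀ j, ∫⁻ y in {y | label j y = label j x}, ‖f y‖ₑ ∂μ ≤
      ENNReal.ofReal (t * vol j)) → |f x| ≤ t) :
    μ {z | t < |∫ w, K z w * f w ∂μ|} ≤
      (ENNReal.ofReal (4 * D) + 5 * B) * ENNReal.ofReal (t ^ (-1 : ℝ)) * ∫⁻ y, ‖f y‖ₑ ∂μ := by
  classical
  choose c Q hQm hQμ hQK using hH
  set S := stoppedCell μ label vol f t with hS
  set g := goodPart μ label vol f t with hg
  have mS : ∀ q, MeasurableSet (S q) := fun q => measurableSet_stoppedCell hd q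
  have hSd : Pairwise fun q q' => Disjoint (S q) (S q') := pairwise_disjoint_stoppedCell
  have mg : Measurable g := measurable_goodPart hd hf
  have hgle : ∫⁻ x, ‖g x‖ₑ ∂μ ≤ ∫⁻ x, ‖f x‖ₑ ∂μ := lintegral_goodPart_le hd
  have hgi : Integrable g μ := ⟨mg.aestronglyMeasurable, hgle.trans_lt hfi.2⟩
  have hDt : 0 ≤ D * t := mul_nonneg (zero_le_one.trans hd.one_le) ht.le
  have hgb : ∀ x, ‖g x‖ₑ ≤ ENNReal.ofReal (D * t) := enorm_goodPart_le hd ht h0 hpt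
  have hgb' : ∀ x, |g x| ≤ D * t := fun x => by
    have := hgb x
    rw [Real.enorm_eq_ofReal_abs] at this
    exact (ENNReal.ofReal_le_ofReal_iff hDt).1 this
  have mKz : ∀ z, Measurable (K z) := fun z => hK.comp measurable_prodMk_left
  have hInt : ∀ z, ∀ h : X → ℝ, Integrable h μ → Integrable (fun w => K z w * h w) μ :=
    fun z h hh => hh.bdd_mul (mKz z).aestronglyMeasurable (Filter.Eventually.of_forall (hM z))
  have mT : ∀ h : X → ℝ, Measurable h → AEMeasurable (fun z => ∫ w, K z w * h w ∂μ) μ := by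
    intro h mh
    have : Measurable fun p : X × X => K p.1 p.2 * h p.2 := hK.mul (mh.comp measurable_snd)
    exact this.stronglyMeasurable.integral_prod_right'.measurable.aemeasurable
  set b := fun x => f x - g x with hb
  have mb : Measurable b := hf.sub mg
  have hbi : Integrable b μ := hfi.sub hgi
  have hble : ∫⁻ x, ‖b x‖ₑ ∂μ ≤ 2 * ∫⁻ x, ‖f x‖ₑ ∂μ := by
    calc ∫⁻ x, ‖b x‖ₑ ∂μ ≤ ∫⁻ x, (‖f x‖ₑ + ‖g x‖ₑ) ∂μ := lintegral_mono fun x => enorm_sub_le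
      _ = ∫⁻ x, ‖f x‖ₑ ∂μ + ∫⁻ x, ‖g x‖ₑ ∂μ := lintegral_add_left hf.enorm _
      _ ≤ _ := by rw [two_mul]; gcongr
  set R := ⋃ q, if (S q).Nonempty then Q q else ∅ with hR
  have hRQ : ∀ q, (S q).Nonempty → Rᶜ ⊆ (Q q)ᶜ := by
    intro q hq
    refine compl_subset_compl.2 fun x hx => mem_iUnion.2 ⟨q, ?_⟩
    rwa [if_pos hq]
  have mR : MeasurableSet R := by
    refine MeasurableSet.iUnion fun q => ?_
    split_ifs
    · exact hQm q
    · exact MeasurableSet.empty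
  have hbad : ∫⁻ z in Rᶜ, ‖∫ w, K z w * b w ∂μ‖ₑ ∂μ ≤ B * (2 * ∫⁻ w, ‖f w‖ₑ ∂μ) := by
    refine (lintegral_bad_part_le hK hM c Q hQK mS hSd (fun q x hx => hx.1) mb hbi ?_ ?_
      hRQ).trans (mul_le_mul_right hble _)
    · intro x hx
      simp only [mem_iUnion, not_exists] at hx
      simp [hb, hg, goodPart_of_notMem hx]
    · exact fun q => setIntegral_sub_goodPart hd q
  have hmR : μ R ≤ B * (ENNReal.ofReal (t ^ (-1 : ℝ)) * ∫⁻ y, ‖f y‖ₑ ∂μ) := by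
    calc μ R ≤ ∑' q, μ (if (S q).Nonempty then Q q else ∅) := measure_iUnion_le _
      _ ≤ ∑' q, B * (ENNReal.ofReal (t ^ (-1 : ℝ)) * ∫⁻ y in S q, ‖f y‖ₑ ∂μ) := by
          refine ENNReal.tsum_le_tsum fun q => ?_
          split_ifs with h
          · obtain ⟨x, hx⟩ := h
            refine (hQμ q).trans ?_
            gcongr
            rw [← stoppedCell_eq_of_mem hd hx, Real.rpow_neg_one, ENNReal.ofReal_inv_of_pos ht,
              mul_comm, ← div_eq_mul_inv, ENNReal.le_div_iff_mul_le (by simp [ht]) (by simp),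
              mul_comm]
            exact mul_measure_stoppedCell_le hd ht q
          · simp
      _ = B * (ENNReal.ofReal (t ^ (-1 : ℝ)) * ∫⁻ y in ⋃ q, S q, ‖f y‖ₑ ∂μ) := by
          rw [ENNReal.tsum_mul_left, ENNReal.tsum_mul_left, lintegral_iUnion mS hSd]
      _ ≤ _ := by
          gcongr
          exact Measure.restrict_le_self
  have hgood : ∫⁻ z, ‖g z‖ₑ ^ 2 ∂μ ≤ ENNReal.ofReal (D * t) * ∫⁻ y, ‖f y‖ₑ ∂μ := by
    calc ∫⁻ z, ‖g z‖ₑ ^ 2 ∂μ ≤ ∫⁻ z, ENNReal.ofReal (D * t) * ‖g z‖ₑ ∂μ := by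
          refine lintegral_mono fun z => ?_
          rw [sq]
          gcongr
          exact hgb z
      _ = ENNReal.ofReal (D * t) * ∫⁻ z, ‖g z‖ₑ ∂μ := lintegral_const_mul _ mg.enorm
      _ ≤ _ := by gcongr
  have hcover : {z | t < |∫ w, K z w * f w ∂μ|} ⊆
      ({z | t / 2 < |∫ w, K z w * g w ∂μ|} ∪ R) ∪ ({z | t / 2 < |∫ w, K z w * b w ∂μ|} ∩ Rᶜ) := by
    intro z hz
    have hz' : t < |∫ w, K z w * f w ∂μ| := hz
    have e : ∫ w, K z w * f w ∂μ = ∫ w, K z w * g w ∂μ + ∫ w, K z w * b w ∂μ := by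
      rw [← integral_add (hInt z g hgi) (hInt z b hbi)]
      congr 1
      ext w
      simp only [hb]
      ring
    rw [e] at hz'
    have h1 := hz'.trans_le (abs_add_le _ _)
    by_cases hzR : z ∈ R
    · exact Or.inl (Or.inr hzR)
    · by_cases h2 : t / 2 < |∫ w, K z w * g w ∂μ|
      · exact Or.inl (Or.inl h2)
      · refine Or.inr ⟨?_, hzR⟩
        simp only [mem_ofPred_eq]
        linarith
  have ht2 : 0 < t / 2 := by linarith
  calc μ {z | t < |∫ w, K z w * f w ∂μ|}
      ≤ (μ {z | t / 2 < |∫ w, K z w * g w ∂μ|} + μ R) +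
        μ ({z | t / 2 < |∫ w, K z w * b w ∂μ|} ∩ Rᶜ) :=
        (measure_mono hcover).trans ((measure_union_le _ _).trans
          (add_le_add_left (measure_union_le _ _) _))
    _ ≤ (ENNReal.ofReal ((t / 2) ^ (-2 : ℝ)) * (ENNReal.ofReal (D * t) * ∫⁻ y, ‖f y‖ₑ ∂μ) +
        B * (ENNReal.ofReal (t ^ (-1 : ℝ)) * ∫⁻ y, ‖f y‖ₑ ∂μ)) +
        ENNReal.ofReal ((t / 2) ^ (-1 : ℝ)) * (B * (2 * ∫⁻ w, ‖f w‖ₑ ∂μ)) := by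
        gcongr
        · refine (measure_lt_abs_le_of_lintegral_sq (mT g mg) ht2).trans ?_
          gcongr
          exact (hL2 g mg hgi ⟨_, hgb'⟩).trans hgood
        · rw [← Measure.restrict_apply₀' mR.compl.nullMeasurableSet]
          refine (measure_lt_abs_le_of_lintegral (mT b mb).restrict ht2).trans ?_
          gcongr
    _ = _ := by
        have e1 : ENNReal.ofReal ((t / 2) ^ (-2 : ℝ)) * ENNReal.ofReal (D * t) =
            ENNReal.ofReal (4 * D) * ENNReal.ofReal (t ^ (-1 : ℝ)) := by
          have hD : 0 ≤ D := zero_le_one.trans hd.one_le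
          rw [← ENNReal.ofReal_mul (by positivity), ← ENNReal.ofReal_mul (by positivity)]
          congr 1
          rw [Real.rpow_neg ht2.le, Real.rpow_neg_one]
          norm_num
          field_simp
          ring
        have e2 : ENNReal.ofReal ((t / 2) ^ (-1 : ℝ)) = 2 * ENNReal.ofReal (t ^ (-1 : ℝ)) := by
          rw [← ENNReal.ofReal_ofNat 2, ← ENNReal.ofReal_mul (by norm_num)]
          congr 1
          rw [Real.rpow_neg_one, Real.rpow_neg_one]
          field_simp
        rw [← mul_assoc, e1, e2]
        ring

end CalderonZygmundWeakType

section CalderonZygmundLp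

/-- Truncation of the real number `a` to the interval `[-t, t]`. -/
noncomputable def clampReal (t a : ℝ) : ℝ := max (-t) (min a t)

theorem measurable_clampReal (t : ℝ) : Measurable (clampReal t) := by
  unfold clampReal
  fun_prop

theorem abs_clampReal {t : ℝ} (ht : 0 < t) (a : ℝ) : |clampReal t a| = min |a| t := by
  unfold clampReal
  simp only [abs_eq_max_neg, max_def, min_def]
  split_ifs <;> linarith

theorem abs_sub_clampReal {t : ℝ} (ht : 0 < t) (a : ℝ) :
    |a - clampReal t a| = max (|a| - t) 0 := by
  unfold clampReal
  simp only [abs_eq_max_neg, max_def, min_def]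
  split_ifs <;> linarith

theorem abs_max_sub_zero_le {t : ℝ} (a b : ℝ) :
    max (|a| - t) 0 - |b - a| ≤ max (|b| - t) 0 := by
  have h := abs_sub_abs_le_abs_sub a b
  rw [abs_sub_comm] at h
  rcases le_total (|a| - t) 0 with h1 | h1
  · rw [max_eq_right h1]
    exact le_trans (by linarith [abs_nonneg (b - a)]) (le_max_right _ _)
  · rw [max_eq_left h1]
    exact le_trans (by linarith) (le_max_left _ _)

/-- Calderón–Zygmund theorem for `1 < p < 2`: an integral operator with bounded kernel that is
contractive on `L²` and satisfies the Hörmander condition is bounded on `L^p`, with a constant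
not depending on the bound for the kernel. -/
theorem lintegral_abs_integral_kernel_rpow_le {X I : Type*} [MeasurableSpace X] {μ : Measure X}
    [SFinite μ] [Countable I] {f : X → ℝ} {D : ℝ}
    {K : X → X → ℝ} (hK : Measurable (Function.uncurry K)) {M : ℝ} (hM : ∀ z w, |K z w| ≤ M)
    (hL2 : ∀ g : X → ℝ, Measurable g → Integrable g μ → (∃ N : ℝ, ∀ x, |g x| ≤ N) →
      ∫⁻ z, ‖∫ w, K z w * g w ∂μ‖ₑ ^ 2 ∂μ ≤ ∫⁻ z, ‖g z‖ₑ ^ 2 ∂μ)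
    {B : ℝ≥0∞}
    (hsys : ∀ V : ℝ, ∃ (label : ℕ → X → I) (vol : ℕ → ℝ), DyadicSystem μ label vol D ∧
      V ≤ vol 0 ∧ (∀ q : ℕ × I, ∃ (c : X) (Q : Set X), MeasurableSet Q ∧
        μ Q ≤ B * μ {x | label q.1 x = q.2} ∧
        ∀ w ∈ {x | label q.1 x = q.2}, ∫⁻ z in Qᶜ, ‖K z w - K z c‖ₑ ∂μ ≤ B) ∧
      ∀ x, ∀ ε > 0, f x ≠ 0 → ∃ j, ∀ y, label j y = label j x → |f y - f x| < ε)
    (hf : Measurable f) (hfi : Integrable f μ) {p : ℝ} (hp₁ : 1 < p) (hp₂ : p < 2) :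
    ∫⁻ z, ENNReal.ofReal (|∫ w, K z w * f w ∂μ| ^ p) ∂μ ≤
      ENNReal.ofReal (2 ^ p) * (ENNReal.ofReal p * (1 * ENNReal.ofReal (1 / p + 1 / (2 - p)) +
        (ENNReal.ofReal (4 * D) + 5 * B) * ENNReal.ofReal (1 / (p - 1)))) *
        ∫⁻ x, ENNReal.ofReal (|f x| ^ p) ∂μ := by
  have mKz : ∀ z, Measurable (K z) := fun z => hK.comp measurable_prodMk_left
  have hInt : ∀ z, ∀ h : X → ℝ, Integrable h μ → Integrable (fun w => K z w * h w) μ :=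
    fun z h hh => hh.bdd_mul (mKz z).aestronglyMeasurable (Filter.Eventually.of_forall (hM z))
  have mT : ∀ h : X → ℝ, Measurable h → AEMeasurable (fun z => ∫ w, K z w * h w ∂μ) μ := by
    intro h mh
    have : Measurable fun p : X × X => K p.1 p.2 * h p.2 := hK.mul (mh.comp measurable_snd)
    exact this.stronglyMeasurable.integral_prod_right'.measurable.aemeasurable
  refine lintegral_rpow_le_of_distribution_le hf (mT f hf).abs (fun x => abs_nonneg _) hp₁ hp₂
    fun t ht => ?_
  set g := fun x => clampReal t (f x) with hg
  set e := fun x => f x - clampReal t (f x) with he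
  have mg : Measurable g := (measurable_clampReal t).comp hf
  have me : Measurable e := hf.sub mg
  have hgi : Integrable g μ := hfi.mono mg.aestronglyMeasurable
    (Filter.Eventually.of_forall fun x => by
      simp only [hg, Real.norm_eq_abs, abs_clampReal ht]
      exact min_le_left _ _)
  have hei : Integrable e μ := hfi.sub hgi
  have habs : ∀ x, |e x| = max (|f x| - t) 0 := fun x => abs_sub_clampReal ht (f x)
  have hgn : ∀ x, ‖g x‖ₑ ^ 2 = ENNReal.ofReal (min |f x| t ^ 2) := fun x => by
    rw [Real.enorm_eq_ofReal_abs, ← ENNReal.ofReal_pow (abs_nonneg _), abs_clampReal ht]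
  have hen : ∀ x, ‖e x‖ₑ = ENNReal.ofReal (max (|f x| - t) 0) := fun x => by
    rw [Real.enorm_eq_ofReal_abs, habs]
  simp_rw [← hgn, ← hen]
  have hcover : {x | 2 * t < |∫ w, K x w * f w ∂μ|} ⊆
      {x | t < |∫ w, K x w * g w ∂μ|} ∪ {x | t < |∫ w, K x w * e w ∂μ|} := by
    intro z hz
    have hz' : 2 * t < |∫ w, K z w * f w ∂μ| := hz
    have e1 : ∫ w, K z w * f w ∂μ = ∫ w, K z w * g w ∂μ + ∫ w, K z w * e w ∂μ := by
      rw [← integral_add (hInt z g hgi) (hInt z e hei)]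
      congr 1
      ext w
      simp only [hg, he]
      ring
    rw [e1] at hz'
    have h1 := hz'.trans_le (abs_add_le _ _)
    by_cases h2 : t < |∫ w, K z w * g w ∂μ|
    · exact Or.inl h2
    · refine Or.inr ?_
      simp only [mem_ofPred_eq]
      linarith
  refine (measure_mono hcover).trans ((measure_union_le _ _).trans (add_le_add ?_ ?_))
  · rw [one_mul]
    refine (measure_lt_abs_le_of_lintegral_sq (mT g mg) ht).trans ?_
    exact mul_le_mul' le_rfl (hL2 g mg hgi ⟨t, fun x => by
      simp only [hg, abs_clampReal ht]
      exact min_le_right _ _⟩)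
  · obtain ⟨label, vol, hd, hV, hH, hpt⟩ := hsys ((∫⁻ y, ‖e y‖ₑ ∂μ).toReal / t)
    refine measure_lt_abs_integral_kernel_le hd hK hM hL2 hH me hei ht ?_ ?_
    · rw [← ENNReal.ofReal_toReal hei.2.ne]
      apply ENNReal.ofReal_le_ofReal
      rwa [div_le_iff₀ ht, mul_comm] at hV
    · intro x hx
      by_contra hlt
      rw [not_le] at hlt
      have hfx : f x ≠ 0 := by
        intro h0
        rw [habs, h0, abs_zero, max_eq_right (by linarith)] at hlt
        linarith
      obtain ⟨j, hj⟩ := hpt x ((|e x| - t) / 2) (by linarith) hfx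
      have hlow : ∀ y ∈ {y | label j y = label j x},
          ENNReal.ofReal (t + (|e x| - t) / 2) ≤ ‖e y‖ₑ := by
        intro y hy
        rw [hen]
        apply ENNReal.ofReal_le_ofReal
        have h1 := abs_max_sub_zero_le (t := t) (f x) (f y)
        have h2 := hj y hy
        rw [← habs x] at h1
        linarith
      have h3 := (setLIntegral_mono' (μ := μ) (hd.measurableSet_cell j (label j x)) hlow).trans
        (hx j)
      rw [lintegral_const, Measure.restrict_apply_univ, hd.measure_cell,
        ← ENNReal.ofReal_mul (by linarith), ENNReal.ofReal_le_ofReal_iff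
          (mul_nonneg ht.le (hd.vol_pos j).le)] at h3
      nlinarith [hd.vol_pos j]

end CalderonZygmundLp

section HeatKernel

/-- The heat kernel in dimension `d` as a function of the squared distance `q` and the time `τ`. -/
noncomputable def heatKer (d : ℕ) (q τ : ℝ) : ℝ :=
  (4 * Real.pi * τ) ^ (-(d / 2 : ℝ)) * Real.exp (-q / (4 * τ))

/-- The time derivative of the heat kernel. -/
noncomputable def heatKerDt (d : ℕ) (q τ : ℝ) : ℝ :=
  (q / (4 * τ ^ 2) - d / (2 * τ)) * heatKer d q τ

variable {d : ℕ} {q τ : ℝ}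

theorem heatKer_pos (hτ : 0 < τ) : 0 < heatKer d q τ := by
  unfold heatKer
  have := Real.pi_pos
  positivity

theorem heatKer_two_mul (hτ : 0 < τ) :
    heatKer d q (2 * τ) = (2 : ℝ) ^ (-(d / 2 : ℝ)) * (4 * Real.pi * τ) ^ (-(d / 2 : ℝ)) *
      Real.exp (-q / (8 * τ)) := by
  unfold heatKer
  have := Real.pi_pos
  rw [← Real.mul_rpow (by norm_num) (by positivity)]
  congr 2 <;> ring

theorem one_add_sq_mul_heatKer_le (hτ : 0 < τ) (hq : 0 ≤ q) :
    (1 + q / τ) ^ 2 * heatKer d q τ ≤ 128 * (2 : ℝ) ^ (d / 2 : ℝ) * heatKer d q (2 * τ) := by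
  have hpi := Real.pi_pos
  have h1 : (1 + q / τ) ^ 2 ≤ 128 * Real.exp (q / (8 * τ)) := by
    have h := Real.quadratic_le_exp_of_nonneg (x := q / (8 * τ)) (by positivity)
    have e : q / (8 * τ) = q / τ / 8 := by ring
    have : 0 ≤ q / τ := by positivity
    rw [e] at h ⊢
    nlinarith
  have h2 : (2 : ℝ) ^ (d / 2 : ℝ) * (2 : ℝ) ^ (-(d / 2 : ℝ)) = 1 := by
    rw [← Real.rpow_add (by norm_num)]
    simp
  have h3 : Real.exp (q / (8 * τ)) * Real.exp (-q / (4 * τ)) = Real.exp (-q / (8 * τ)) := by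
    rw [← Real.exp_add]
    congr 1
    field_simp
    ring
  rw [heatKer_two_mul hτ]
  calc (1 + q / τ) ^ 2 * heatKer d q τ ≤ 128 * Real.exp (q / (8 * τ)) * heatKer d q τ := by
        gcongr
        exact (heatKer_pos hτ).le
    _ = 128 * (4 * Real.pi * τ) ^ (-(d / 2 : ℝ)) *
        (Real.exp (q / (8 * τ)) * Real.exp (-q / (4 * τ))) := by
      unfold heatKer
      ring
    _ = _ := by
      rw [h3]
      linear_combination (-128 * (4 * Real.pi * τ) ^ (-(d / 2 : ℝ)) *
        Real.exp (-q / (8 * τ))) * h2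

theorem hasDerivAt_heatKer {a b : ℝ → ℝ} {a' b' θ : ℝ} (ha : HasDerivAt a a' θ)
    (hb : HasDerivAt b b' θ) (hpos : 0 < b θ) :
    HasDerivAt (fun θ => heatKer d (a θ) (b θ))
      ((-a' / (4 * b θ)) * heatKer d (a θ) (b θ) + b' * heatKerDt d (a θ) (b θ)) θ := by
  have hpi := Real.pi_pos
  have h1 := (hb.const_mul (4 * Real.pi)).rpow_const (p := -(d / 2 : ℝ)) (Or.inl (by positivity))
  have h2 := (ha.neg.div (hb.const_mul 4) (by positivity)).exp
  refine (h1.mul h2).congr_deriv ?_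
  unfold heatKerDt heatKer
  have e : (4 * Real.pi * b θ) ^ (-(d / 2 : ℝ) - 1) =
      (4 * Real.pi * b θ) ^ (-(d / 2 : ℝ)) / (4 * Real.pi * b θ) := by
    rw [Real.rpow_sub_one (by positivity)]
  rw [e]
  simp only [Pi.neg_apply, Pi.div_apply]
  field_simp
  ring

theorem hasDerivAt_heatKerDt {a b : ℝ → ℝ} {a' b' θ : ℝ} (ha : HasDerivAt a a' θ)
    (hb : HasDerivAt b b' θ) (hpos : 0 < b θ) :
    HasDerivAt (fun θ => heatKerDt d (a θ) (b θ))
      ((a' * (1 / (4 * b θ ^ 2) - (a θ / (4 * b θ ^ 2) - d / (2 * b θ)) / (4 * b θ)) +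
        b' * (-a θ / (2 * b θ ^ 3) + d / (2 * b θ ^ 2) +
          (a θ / (4 * b θ ^ 2) - d / (2 * b θ)) ^ 2)) * heatKer d (a θ) (b θ)) θ := by
  have h1 := (ha.div ((hb.pow 2).const_mul 4) (by simp; positivity)).sub
    ((hasDerivAt_const θ (d : ℝ)).div (hb.const_mul 2) (by positivity))
  refine (h1.mul (hasDerivAt_heatKer ha hb hpos)).congr_deriv ?_
  unfold heatKerDt
  simp only [Pi.div_apply, Pi.sub_apply, Pi.pow_apply]
  field_simp
  ring

theorem abs_heatKerDt_le (hτ : 0 < τ) (hq : 0 ≤ q) :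
    |heatKerDt d q τ| ≤ (1 + d) * τ⁻¹ * ((1 + q / τ) * heatKer d q τ) := by
  unfold heatKerDt
  rw [abs_mul, abs_of_pos (heatKer_pos hτ), ← mul_assoc]
  gcongr
  · exact (heatKer_pos hτ).le
  have e : q / (4 * τ ^ 2) - d / (2 * τ) = τ⁻¹ * (q / τ / 4 - d / 2) := by
    field_simp
  have h0 : 0 ≤ q / τ := by positivity
  have hd : (0 : ℝ) ≤ d := Nat.cast_nonneg d
  rw [e, abs_mul, abs_of_pos (inv_pos.2 hτ), mul_comm (1 + (d : ℝ)), mul_assoc]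
  gcongr
  rw [abs_le]
  constructor <;> nlinarith [mul_nonneg hd h0]

theorem abs_heatKerDt_le' (hτ : 0 < τ) (hq : 0 ≤ q) :
    |heatKerDt d q τ| ≤ (1 + d) * (128 * (2 : ℝ) ^ (d / 2 : ℝ)) * τ⁻¹ * heatKer d q (2 * τ) := by
  have h0 : 0 ≤ q / τ := by positivity
  have h1 : (1 + q / τ) * heatKer d q τ ≤ (1 + q / τ) ^ 2 * heatKer d q τ :=
    mul_le_mul_of_nonneg_right (by nlinarith) (heatKer_pos hτ).le
  calc _ ≤ (1 + d) * τ⁻¹ * (128 * (2 : ℝ) ^ (d / 2 : ℝ) * heatKer d q (2 * τ)) :=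
        (abs_heatKerDt_le hτ hq).trans (by
          exact mul_le_mul_of_nonneg_left (h1.trans (one_add_sq_mul_heatKer_le hτ hq))
            (by positivity))
    _ = _ := by ring

theorem abs_heatKerDt_le_of_sq_le {ρ : ℝ} (hτ : 0 < τ) (hρ : 0 < ρ) (hq : ρ ^ 2 ≤ q) :
    |heatKerDt d q τ| ≤
      (1 + d) * (128 * (2 : ℝ) ^ (d / 2 : ℝ)) * (ρ ^ 2)⁻¹ * heatKer d q (2 * τ) := by
  have hq0 : 0 < q := lt_of_lt_of_le (by positivity) hq
  have h0 : 0 ≤ q / τ := by positivity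
  have h1 : τ⁻¹ * (1 + q / τ) ≤ (ρ ^ 2)⁻¹ * (1 + q / τ) ^ 2 := by
    have : τ⁻¹ ≤ (ρ ^ 2)⁻¹ * (q / τ) := by
      rw [div_eq_mul_inv, ← mul_assoc]
      refine le_mul_of_one_le_left (by positivity) ?_
      rw [inv_mul_eq_div, one_le_div (by positivity)]
      exact hq
    calc _ ≤ (ρ ^ 2)⁻¹ * (q / τ) * (1 + q / τ) := by gcongr
      _ ≤ (ρ ^ 2)⁻¹ * (1 + q / τ) * (1 + q / τ) := by
        gcongr
        linarith
      _ = _ := by ring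
  calc _ ≤ (1 + d) * ((ρ ^ 2)⁻¹ * (1 + q / τ) ^ 2 * heatKer d q τ) :=
        (abs_heatKerDt_le hτ hq0.le).trans (by
          rw [mul_assoc, ← mul_assoc τ⁻¹]
          gcongr
          exact (heatKer_pos hτ).le)
    _ ≤ (1 + d) * ((ρ ^ 2)⁻¹ * (128 * (2 : ℝ) ^ (d / 2 : ℝ) * heatKer d q (2 * τ))) := by
      rw [mul_assoc (ρ ^ 2)⁻¹]
      have := one_add_sq_mul_heatKer_le (d := d) hτ hq0.le
      exact mul_le_mul_of_nonneg_left (mul_le_mul_of_nonneg_left this (by positivity))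
        (by positivity)
    _ = _ := by ring

/-- Bound for the derivative of `heatKerDt` along a path whose speed is at most `ρ` in space and
`ρ ^ 2` in time. -/
theorem abs_deriv_heatKerDt_le {a' b' ρ : ℝ} (hτ : 0 < τ) (hq : 0 ≤ q) (hρ : 0 ≤ ρ)
    (hρτ : ρ ^ 2 ≤ τ) (ha : |a'| ≤ 2 * ρ * √q) (hb : |b'| ≤ ρ ^ 2) :
    |(a' * (1 / (4 * τ ^ 2) - (q / (4 * τ ^ 2) - d / (2 * τ)) / (4 * τ)) +
        b' * (-q / (2 * τ ^ 3) + d / (2 * τ ^ 2) +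
          (q / (4 * τ ^ 2) - d / (2 * τ)) ^ 2)) * heatKer d q τ| ≤
      3 * (1 + d) ^ 2 * (128 * (2 : ℝ) ^ (d / 2 : ℝ)) * (ρ / (τ * √τ)) * heatKer d q (2 * τ) := by
  have hd : (0 : ℝ) ≤ d := Nat.cast_nonneg d
  set m := q / τ with hm
  have hm0 : 0 ≤ m := by positivity
  have hs : 0 < √τ := Real.sqrt_pos.2 hτ
  have hss : √τ * √τ = τ := Real.mul_self_sqrt hτ.le
  have hsq : √q ≤ √τ * (1 + m) := by
    rw [Real.sqrt_le_left (by positivity), mul_pow, Real.sq_sqrt hτ.le]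
    have : q = τ * m := by
      rw [hm]
      field_simp
    rw [this]
    gcongr
    nlinarith
  have hρs : ρ ≤ √τ := Real.le_sqrt_of_sq_le hρτ
  have e1 : 1 / (4 * τ ^ 2) - (q / (4 * τ ^ 2) - d / (2 * τ)) / (4 * τ) =
      (τ ^ 2)⁻¹ * (1 / 4 - m / 16 + d / 8) := by
    rw [hm]
    field_simp
    ring
  have e2 : -q / (2 * τ ^ 3) + d / (2 * τ ^ 2) + (q / (4 * τ ^ 2) - d / (2 * τ)) ^ 2 =
      (τ ^ 2)⁻¹ * (-m / 2 + d / 2 + (m / 4 - d / 2) ^ 2) := by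
    rw [hm]
    field_simp
  have b1 : |1 / 4 - m / 16 + d / 8| ≤ (1 + d) ^ 2 * (1 + m) := by
    rw [abs_le]
    constructor <;> nlinarith [mul_nonneg hd hm0, mul_nonneg (mul_nonneg hd hd) hm0]
  have b2 : |-m / 2 + d / 2 + (m / 4 - d / 2) ^ 2| ≤ (1 + d) ^ 2 * (1 + m) ^ 2 := by
    have := mul_nonneg hd hm0
    have := mul_nonneg (mul_nonneg hd hd) hm0
    have := mul_nonneg (mul_nonneg hm0 hm0) hd
    have := mul_nonneg (mul_nonneg hm0 hm0) (mul_nonneg hd hd)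
    rw [abs_le]
    constructor <;> nlinarith
  have key : |a' * (1 / (4 * τ ^ 2) - (q / (4 * τ ^ 2) - d / (2 * τ)) / (4 * τ)) +
        b' * (-q / (2 * τ ^ 3) + d / (2 * τ ^ 2) +
          (q / (4 * τ ^ 2) - d / (2 * τ)) ^ 2)| ≤
      3 * (1 + d) ^ 2 * (ρ / (τ * √τ)) * (1 + m) ^ 2 := by
    rw [e1, e2]
    have t1 : |a' * ((τ ^ 2)⁻¹ * (1 / 4 - m / 16 + d / 8))| ≤
        2 * ρ * (√τ * (1 + m)) * ((τ ^ 2)⁻¹ * ((1 + d) ^ 2 * (1 + m))) := by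
      rw [abs_mul, abs_mul, abs_of_pos (a := (τ ^ 2)⁻¹) (by positivity)]
      gcongr
      exact ha.trans (by gcongr)
    have t2 : |b' * ((τ ^ 2)⁻¹ * (-m / 2 + d / 2 + (m / 4 - d / 2) ^ 2))| ≤
        ρ * √τ * ((τ ^ 2)⁻¹ * ((1 + d) ^ 2 * (1 + m) ^ 2)) := by
      rw [abs_mul, abs_mul, abs_of_pos (a := (τ ^ 2)⁻¹) (by positivity)]
      gcongr
      exact hb.trans (by
        rw [pow_two]
        gcongr)
    have e3 : √τ * (τ ^ 2)⁻¹ = 1 / (τ * √τ) := by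
      rw [← hss]
      field_simp
      simp [hs.le]
    refine (abs_add_le _ _).trans ((add_le_add t1 t2).trans (le_of_eq ?_))
    linear_combination (3 * ρ * (1 + d) ^ 2 * (1 + m) ^ 2) * e3
  rw [abs_mul, abs_of_pos (heatKer_pos hτ)]
  calc _ ≤ 3 * (1 + d) ^ 2 * (ρ / (τ * √τ)) * (1 + m) ^ 2 * heatKer d q τ := by
        gcongr
        exact (heatKer_pos hτ).le
    _ = 3 * (1 + d) ^ 2 * (ρ / (τ * √τ)) * ((1 + m) ^ 2 * heatKer d q τ) := by ring
    _ ≤ 3 * (1 + d) ^ 2 * (ρ / (τ * √τ)) *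
        (128 * (2 : ℝ) ^ (d / 2 : ℝ) * heatKer d q (2 * τ)) :=
      mul_le_mul_of_nonneg_left (one_add_sq_mul_heatKer_le hτ hq) (by positivity)
    _ = _ := by ring

end HeatKernel

section SingularKernel

theorem contDiffAt_heatKer {d : ℕ} {x : ℝ × ℝ} (hx : 0 < x.2) {m : WithTop ℕ∞} :
    ContDiffAt ℝ m (fun x : ℝ × ℝ => heatKer d x.1 x.2) x := by
  have hpi := Real.pi_pos
  unfold heatKer
  refine ContDiffAt.mul ?_ ?_
  · exact (contDiffAt_const.mul contDiffAt_snd).rpow_const_of_ne (by positivity)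
  · exact ((contDiffAt_fst.neg).div (contDiffAt_const.mul contDiffAt_snd) (by positivity)).exp

theorem contDiffAt_heatKerDt {d : ℕ} {x : ℝ × ℝ} (hx : 0 < x.2) {m : WithTop ℕ∞} :
    ContDiffAt ℝ m (fun x : ℝ × ℝ => heatKerDt d x.1 x.2) x := by
  unfold heatKerDt
  refine ContDiffAt.mul (ContDiffAt.sub ?_ ?_) (contDiffAt_heatKer hx)
  · exact contDiffAt_fst.div (contDiffAt_const.mul (contDiffAt_snd.pow 2)) (by positivity)
  · exact contDiffAt_const.div (contDiffAt_const.mul contDiffAt_snd) (by positivity)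

theorem measurable_heatKer (d : ℕ) : Measurable fun x : ℝ × ℝ => heatKer d x.1 x.2 := by
  unfold heatKer
  fun_prop

theorem measurable_heatKerDt (d : ℕ) : Measurable fun x : ℝ × ℝ => heatKerDt d x.1 x.2 := by
  unfold heatKerDt heatKer
  fun_prop

/-- The constant in the pointwise bounds for the heat kernel. -/
noncomputable def heatConst (d : ℕ) : ℝ := 3 * (1 + d) ^ 2 * (128 * (2 : ℝ) ^ (d / 2 : ℝ))

theorem heatConst_pos (d : ℕ) : 0 < heatConst d := by
  unfold heatConst
  positivity

theorem le_heatConst (d : ℕ) : (1 + d) * (128 * (2 : ℝ) ^ (d / 2 : ℝ)) ≤ heatConst d := by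
  unfold heatConst
  gcongr
  nlinarith [(Nat.cast_nonneg d : (0 : ℝ) ≤ d)]

theorem enorm_heatKerDt_le {d : ℕ} {q τ : ℝ} (hτ : 0 < τ) (hq : 0 ≤ q) :
    ‖heatKerDt d q τ‖ₑ ≤
      ENNReal.ofReal (heatConst d * τ⁻¹) * ENNReal.ofReal (heatKer d q (2 * τ)) := by
  have hc := heatConst_pos d
  have := (heatKer_pos (d := d) (q := q) (show 0 < 2 * τ by positivity)).le
  rw [Real.enorm_eq_ofReal_abs, ← ENNReal.ofReal_mul (by positivity)]
  refine ENNReal.ofReal_le_ofReal ((abs_heatKerDt_le' hτ hq).trans ?_)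
  gcongr
  exact le_heatConst d

theorem enorm_heatKerDt_le_of_sq_le {d : ℕ} {q τ ρ : ℝ} (hτ : 0 < τ) (hρ : 0 < ρ)
    (hq : ρ ^ 2 ≤ q) :
    ‖heatKerDt d q τ‖ₑ ≤
      ENNReal.ofReal (heatConst d * (ρ ^ 2)⁻¹) * ENNReal.ofReal (heatKer d q (2 * τ)) := by
  have hc := heatConst_pos d
  have := (heatKer_pos (d := d) (q := q) (show 0 < 2 * τ by positivity)).le
  rw [Real.enorm_eq_ofReal_abs, ← ENNReal.ofReal_mul (by positivity)]
  refine ENNReal.ofReal_le_ofReal ((abs_heatKerDt_le_of_sq_le hτ hρ hq).trans ?_)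
  gcongr
  exact le_heatConst d

variable {V : Type*} [NormedAddCommGroup V] [InnerProductSpace ℝ V]

/-- The kernel of the operator `g ↦ Δ (∂_t - Δ)⁻¹ g`, regularized by the time shift `ε`. -/
noncomputable def singKer (ε : ℝ) (z w : V × ℝ) : ℝ :=
  if w.2 < z.2 then heatKerDt (Module.finrank ℝ V) (‖z.1 - w.1‖ ^ 2) (z.2 - w.2 + ε) else 0

theorem abs_singKer_le {ε : ℝ} (hε : 0 < ε) (z w : V × ℝ) :
    |singKer ε z w| ≤ heatConst (Module.finrank ℝ V) * ε⁻¹ *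
      (4 * Real.pi * (2 * ε)) ^ (-(Module.finrank ℝ V / 2 : ℝ)) := by
  have hpi := Real.pi_pos
  have hc := heatConst_pos (Module.finrank ℝ V)
  unfold singKer
  split_ifs with h
  · have hτ : 0 < z.2 - w.2 + ε := by linarith
    have hτ' : ε ≤ z.2 - w.2 + ε := by linarith
    refine (abs_heatKerDt_le' hτ (by positivity)).trans ?_
    have hk : heatKer (Module.finrank ℝ V) (‖z.1 - w.1‖ ^ 2) (2 * (z.2 - w.2 + ε)) ≤
        (4 * Real.pi * (2 * ε)) ^ (-(Module.finrank ℝ V / 2 : ℝ)) := by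
      unfold heatKer
      refine (mul_le_of_le_one_right (by positivity) (Real.exp_le_one_iff.2 ?_)).trans ?_
      · rw [neg_div]
        have : 0 ≤ ‖z.1 - w.1‖ ^ 2 / (4 * (2 * (z.2 - w.2 + ε))) := by positivity
        linarith
      · refine Real.rpow_le_rpow_of_nonpos (by positivity) (by gcongr) ?_
        rw [neg_nonpos]
        positivity
    refine mul_le_mul ?_ hk (heatKer_pos (by positivity)).le (by positivity)
    have := le_heatConst (Module.finrank ℝ V)
    gcongr
  · rw [abs_zero]
    positivity

variable [FiniteDimensional ℝ V] [MeasurableSpace V] [BorelSpace V]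

theorem integrable_heatKer {τ : ℝ} (hτ : 0 < τ) :
    Integrable fun x : V => heatKer (Module.finrank ℝ V) (‖x‖ ^ 2) τ := by
  refine Integrable.const_mul ?_ _
  have h := (GaussianFourier.integrable_cexp_neg_mul_sq_norm_add (V := V) (b := ((4 * τ)⁻¹ : ℝ))
    (by rw [Complex.ofReal_re]; positivity) 0 0).norm
  refine h.congr (Filter.Eventually.of_forall fun x => ?_)
  simp only [Complex.norm_exp]
  congr 1
  have : (-((((4 * τ)⁻¹ : ℝ)) : ℂ) * (‖x‖ : ℂ) ^ 2 + 0 * (inner ℝ (0 : V) x : ℂ)) =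
    ((-‖x‖ ^ 2 / (4 * τ) : ℝ) : ℂ) := by
    push_cast
    ring
  rw [this, Complex.ofReal_re]

theorem integral_heatKer {τ : ℝ} (hτ : 0 < τ) :
    ∫ x : V, heatKer (Module.finrank ℝ V) (‖x‖ ^ 2) τ = 1 := by
  have hpi := Real.pi_pos
  have h := GaussianFourier.integral_rexp_neg_mul_sq_norm (V := V) (b := (4 * τ)⁻¹) (by positivity)
  unfold heatKer
  rw [integral_const_mul]
  have e : ∀ x : V, Real.exp (-‖x‖ ^ 2 / (4 * τ)) = Real.exp (-(4 * τ)⁻¹ * ‖x‖ ^ 2) := by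
    intro x
    congr 1
    ring
  simp_rw [e]
  rw [h, div_inv_eq_mul, show Real.pi * (4 * τ) = 4 * Real.pi * τ by ring,
    ← Real.rpow_add (by positivity)]
  simp

theorem lintegral_heatKer {τ : ℝ} (hτ : 0 < τ) (y : V) :
    ∫⁻ x : V, ENNReal.ofReal (heatKer (Module.finrank ℝ V) (‖x - y‖ ^ 2) τ) = 1 := by
  rw [lintegral_sub_right_eq_self
    (fun x => ENNReal.ofReal (heatKer (Module.finrank ℝ V) (‖x‖ ^ 2) τ)) y,
    ← ofReal_integral_eq_lintegral_ofReal (integrable_heatKer hτ)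
    (Filter.Eventually.of_forall fun x => (heatKer_pos hτ).le), integral_heatKer hτ,
    ENNReal.ofReal_one]

theorem measurable_singKer (ε : ℝ) : Measurable (Function.uncurry (singKer (V := V) ε)) := by
  unfold singKer
  refine Measurable.ite ?_ ?_ measurable_const
  · exact measurableSet_lt (by fun_prop) (by fun_prop)
  · exact (measurable_heatKerDt _).comp
      (f := fun p : (V × ℝ) × (V × ℝ) => (‖p.1.1 - p.2.1‖ ^ 2, p.1.2 - p.2.2 + ε)) (by fun_prop)

theorem lintegral_enorm_heatKerDt_le {τ : ℝ} (hτ : 0 < τ) (y : V) :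
    ∫⁻ x : V, ‖heatKerDt (Module.finrank ℝ V) (‖x - y‖ ^ 2) τ‖ₑ ≤
      ENNReal.ofReal (heatConst (Module.finrank ℝ V) * τ⁻¹) := by
  refine (lintegral_mono fun x => enorm_heatKerDt_le hτ (by positivity)).trans ?_
  rw [lintegral_const_mul' _ _ ENNReal.ofReal_ne_top, lintegral_heatKer (by positivity), mul_one]

/-- Bound for the increments of `singKer` at times far from the singularity. -/
theorem lintegral_singKer_sub_le {ε ρ t : ℝ} (hε : 0 < ε) (hρ : 0 < ρ) {w c : V × ℝ}
    (h1 : ‖w.1 - c.1‖ ≤ ρ) (h2 : |w.2 - c.2| ≤ ρ ^ 2) (ht : 3 * ρ ^ 2 < t - c.2 - ρ ^ 2) :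
    ∫⁻ x : V, ‖singKer ε (x, t) w - singKer ε (x, t) c‖ₑ ≤
      ENNReal.ofReal (heatConst (Module.finrank ℝ V) *
        (ρ * (t - c.2 - ρ ^ 2) ^ (-(3 / 2) : ℝ))) := by
  set d := Module.finrank ℝ V
  set σ := t - c.2 - ρ ^ 2 with hσ
  have hσ0 : 0 < σ := lt_trans (by positivity) ht
  have hc := heatConst_pos d
  set y : ℝ → V := fun θ => c.1 + θ • (w.1 - c.1) with hy
  set b : ℝ → ℝ := fun θ => t - (c.2 + θ * (w.2 - c.2)) + ε with hb
  have hbσ : ∀ θ ∈ Icc (0 : ℝ) 1, σ ≤ b θ := by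
    intro θ hθ
    have : |θ * (w.2 - c.2)| ≤ ρ ^ 2 := by
      rw [abs_mul, abs_of_nonneg hθ.1]
      exact (mul_le_of_le_one_left (abs_nonneg _) hθ.2).trans h2
    have := abs_le.1 this
    simp only [hb, hσ]
    linarith
  have hpt : ∀ x : V, ‖singKer ε (x, t) w - singKer ε (x, t) c‖ₑ ≤
      ∫⁻ θ in Icc (0 : ℝ) 1, ENNReal.ofReal (heatConst d * (ρ * σ ^ (-(3 / 2) : ℝ))) *
        ENNReal.ofReal (heatKer d (‖x - y θ‖ ^ 2) (2 * b θ)) := by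
    intro x
    set F : ℝ → ℝ := fun θ => heatKerDt d (‖x - y θ‖ ^ 2) (b θ) with hF
    have e1 : singKer ε (x, t) w = F 1 := by
      have hlt : w.2 < t := by
        have := abs_le.1 h2
        nlinarith
      simp only [singKer, hF, hy, hb, hlt, if_true]
      congr 3
      · simp
      · ring
    have e0 : singKer ε (x, t) c = F 0 := by
      have hlt : c.2 < t := by nlinarith
      simp only [singKer, hF, hy, hb, hlt, if_true]
      congr 3
      · simp
      · ring
    have hcd : ContDiffOn ℝ 1 F (Icc 0 1) := by
      intro θ hθ
      have hpos := hσ0.trans_le (hbσ θ hθ)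
      have hp : ContDiffAt ℝ 1 (fun θ => (‖x - y θ‖ ^ 2, b θ)) θ := by
        refine ContDiffAt.prodMk ?_ ?_
        · refine ContDiffAt.norm_sq ℝ ?_
          simp only [hy]
          fun_prop
        · simp only [hb]
          fun_prop
      exact (ContDiffAt.comp θ (contDiffAt_heatKerDt (d := d) (x := (‖x - y θ‖ ^ 2, b θ)) hpos)
        hp).contDiffWithinAt
    rw [e1, e0]
    refine (enorm_sub_le_lintegral_deriv_of_contDiffOn_Icc hcd zero_le_one).trans ?_
    refine setLIntegral_mono' measurableSet_Icc fun θ hθ => ?_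
    have hb0 := hbσ θ hθ
    have hpos := hσ0.trans_le hb0
    have hyd : HasDerivAt (fun θ => x - y θ) (-(w.1 - c.1)) θ := by
      have := (((hasDerivAt_id θ).smul_const (w.1 - c.1)).const_add c.1).const_sub x
      simpa using this
    have hq := hyd.norm_sq
    have hbd : HasDerivAt b (-(w.2 - c.2)) θ := by
      have := ((((hasDerivAt_id θ).mul_const (w.2 - c.2)).const_add c.2).const_sub t).add_const ε
      exact this.congr_deriv (by simp)
    rw [(hasDerivAt_heatKerDt (d := d) hq hbd hpos).deriv]
    have hk := (heatKer_pos (d := d) (q := ‖x - y θ‖ ^ 2) (show 0 < 2 * b θ by positivity)).le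
    rw [Real.enorm_eq_ofReal_abs, ← ENNReal.ofReal_mul (by positivity)]
    refine ENNReal.ofReal_le_ofReal ((abs_deriv_heatKerDt_le hpos (by positivity) hρ.le
      ?_ ?_ ?_).trans ?_)
    · nlinarith
    · rw [Real.sqrt_sq (norm_nonneg _), abs_mul, abs_two]
      have := abs_real_inner_le_norm (x - y θ) (-(w.1 - c.1))
      rw [norm_neg] at this
      have h3 := mul_le_mul_of_nonneg_left h1 (norm_nonneg (x - y θ))
      nlinarith
    · rw [abs_neg]
      exact h2
    · unfold heatConst
      gcongr
      rw [div_eq_mul_inv]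
      gcongr
      have e : b θ * √(b θ) = (b θ) ^ (3 / 2 : ℝ) := by
        rw [Real.sqrt_eq_rpow]
        nth_rewrite 1 [← Real.rpow_one (b θ)]
        rw [← Real.rpow_add hpos]
        norm_num
      rw [e, ← Real.rpow_neg hpos.le]
      exact Real.rpow_le_rpow_of_nonpos hσ0 hb0 (by norm_num)
  refine (lintegral_mono hpt).trans ?_
  rw [lintegral_lintegral_swap]
  · have : ∀ θ ∈ Icc (0 : ℝ) 1, ∫⁻ x : V, ENNReal.ofReal (heatConst d * (ρ * σ ^ (-(3 / 2) : ℝ))) *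
        ENNReal.ofReal (heatKer d (‖x - y θ‖ ^ 2) (2 * b θ)) =
        ENNReal.ofReal (heatConst d * (ρ * σ ^ (-(3 / 2) : ℝ))) := by
      intro θ hθ
      have hpos := hσ0.trans_le (hbσ θ hθ)
      rw [lintegral_const_mul' _ _ ENNReal.ofReal_ne_top, lintegral_heatKer (by positivity),
        mul_one]
    rw [setLIntegral_congr_fun measurableSet_Icc this, setLIntegral_const, Real.volume_Icc]
    simp
  · refine (Measurable.const_mul (ENNReal.measurable_ofReal.comp
      ((measurable_heatKer d).comp
        (f := fun p : V × ℝ => (‖p.1 - y p.2‖ ^ 2, 2 * b p.2)) ?_)) _).aemeasurable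
    simp only [hy, hb]
    fun_prop

theorem lintegral_singKer_compl_ball_le {ε ρ t : ℝ} (hε : 0 < ε) (hρ : 0 < ρ) {w : V × ℝ} {y : V}
    (h1 : ‖w.1 - y‖ ≤ ρ) :
    ∫⁻ x in {x : V | 2 * ρ < ‖x - y‖}, ‖singKer ε (x, t) w‖ₑ ≤
      ENNReal.ofReal (heatConst (Module.finrank ℝ V) * (ρ ^ 2)⁻¹) := by
  by_cases ht : w.2 < t
  · have hτ : 0 < t - w.2 + ε := by linarith
    have : ∀ x ∈ {x : V | 2 * ρ < ‖x - y‖}, ‖singKer ε (x, t) w‖ₑ ≤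
        ENNReal.ofReal (heatConst (Module.finrank ℝ V) * (ρ ^ 2)⁻¹) * ENNReal.ofReal
          (heatKer (Module.finrank ℝ V) (‖x - w.1‖ ^ 2) (2 * (t - w.2 + ε))) := by
      intro x hx
      have hx' : 2 * ρ < ‖x - y‖ := hx
      simp only [singKer, ht, if_true]
      refine enorm_heatKerDt_le_of_sq_le hτ hρ ?_
      have := norm_add_le (x - w.1) (w.1 - y)
      rw [sub_add_sub_cancel] at this
      gcongr
      linarith
    refine (setLIntegral_mono' (measurableSet_lt measurable_const (by fun_prop)) this).trans ?_
    refine (setLIntegral_le_lintegral _ _).trans ?_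
    rw [lintegral_const_mul' _ _ ENNReal.ofReal_ne_top, lintegral_heatKer (by positivity), mul_one]
  · simp [singKer, ht]

theorem lintegral_rpow_sub_indicator_le {ρ a : ℝ} (hρ : 0 < ρ) :
    ∫⁻ t : ℝ, (Ioi (3 * ρ ^ 2)).indicator
      (fun s => ENNReal.ofReal (ρ * s ^ (-(3 / 2) : ℝ))) (t - a) ≤ 2 := by
  rw [lintegral_sub_right_eq_self (fun t => (Ioi (3 * ρ ^ 2)).indicator
      (fun s => ENNReal.ofReal (ρ * s ^ (-(3 / 2) : ℝ))) t) a,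
    lintegral_indicator measurableSet_Ioi]
  have h3 : 0 < 3 * ρ ^ 2 := by positivity
  have hi : IntegrableOn (fun s : ℝ => ρ * s ^ (-(3 / 2) : ℝ)) (Ioi (3 * ρ ^ 2)) :=
    (integrableOn_Ioi_rpow_of_lt (by norm_num) h3).const_mul _
  rw [← ofReal_integral_eq_lintegral_ofReal hi, integral_const_mul,
    integral_Ioi_rpow_of_lt (by norm_num) h3, ← ENNReal.ofReal_ofNat 2]
  · refine ENNReal.ofReal_le_ofReal ?_
    have : (3 * ρ ^ 2) ^ (-(3 / 2) + 1 : ℝ) ≤ ρ⁻¹ := by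
      rw [show (-(3 / 2) + 1 : ℝ) = -(1 / 2) by norm_num, Real.rpow_neg h3.le,
        ← Real.sqrt_eq_rpow]
      gcongr
      exact Real.le_sqrt_of_sq_le (by nlinarith)
    have h := mul_le_mul_of_nonneg_left this hρ.le
    rw [mul_inv_cancel₀ hρ.ne'] at h
    rw [show (-(3 / 2) + 1 : ℝ) = -(1 / 2) by norm_num] at h ⊢
    linarith
  · filter_upwards [self_mem_ae_restrict measurableSet_Ioi] with s hs
    have : 0 < s := h3.trans hs
    positivity

/-- The Hörmander condition for the regularized kernel, with a constant independent of `ε`. -/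
theorem lintegral_singKer_hormander {ε ρ : ℝ} (hε : 0 < ε) (hρ : 0 < ρ) {w c : V × ℝ}
    (h1 : ‖w.1 - c.1‖ ≤ ρ) (h2 : |w.2 - c.2| ≤ ρ ^ 2) :
    ∫⁻ z in (closedBall c.1 (2 * ρ) ×ˢ Icc (c.2 - 4 * ρ ^ 2) (c.2 + 4 * ρ ^ 2))ᶜ,
      ‖singKer ε z w - singKer ε z c‖ₑ ≤
      ENNReal.ofReal (18 * heatConst (Module.finrank ℝ V)) := by
  set d := Module.finrank ℝ V
  have hc := heatConst_pos d
  set Q := closedBall c.1 (2 * ρ) ×ˢ Icc (c.2 - 4 * ρ ^ 2) (c.2 + 4 * ρ ^ 2) with hQ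
  have mQ : MeasurableSet Q := measurableSet_closedBall.prod measurableSet_Icc
  have mK : ∀ v : V × ℝ, Measurable fun z => singKer ε z v :=
    fun v => (measurable_singKer ε).comp measurable_prodMk_right
  have mD : Measurable fun z => ‖singKer ε z w - singKer ε z c‖ₑ := ((mK w).sub (mK c)).enorm
  rw [← lintegral_indicator mQ.compl, Measure.volume_eq_prod,
    lintegral_prod_symm' _ (mD.indicator mQ.compl)]
  have hslice : ∀ t : ℝ, ∫⁻ x : V,
      Qᶜ.indicator (fun z => ‖singKer ε z w - singKer ε z c‖ₑ) (x, t) ≤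
      (Icc (c.2 - 4 * ρ ^ 2) (c.2 + 4 * ρ ^ 2)).indicator
        (fun _ => ENNReal.ofReal (2 * (heatConst d * (ρ ^ 2)⁻¹))) t +
      ENNReal.ofReal (heatConst d) * (Ioi (3 * ρ ^ 2)).indicator
        (fun s => ENNReal.ofReal (ρ * s ^ (-(3 / 2) : ℝ))) (t - (c.2 + ρ ^ 2)) := by
    intro t
    by_cases ht : t ∈ Icc (c.2 - 4 * ρ ^ 2) (c.2 + 4 * ρ ^ 2)
    · refine le_trans ?_ le_self_add
      rw [indicator_of_mem ht]
      have mS : MeasurableSet {x : V | 2 * ρ < ‖x - c.1‖} :=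
        measurableSet_lt measurable_const (by fun_prop)
      calc _ ≤ ∫⁻ x in {x : V | 2 * ρ < ‖x - c.1‖},
            (‖singKer ε (x, t) w‖ₑ + ‖singKer ε (x, t) c‖ₑ) := by
            rw [← lintegral_indicator mS]
            refine lintegral_mono fun x => ?_
            by_cases hx : 2 * ρ < ‖x - c.1‖
            · rw [indicator_of_mem (show x ∈ {x : V | 2 * ρ < ‖x - c.1‖} from hx)]
              exact (indicator_le_self _ _ _).trans (enorm_sub_le)
            · rw [indicator_of_notMem]
              · exact zero_le
              · simp only [mem_compl_iff, not_not, hQ, mem_prod, mem_closedBall, dist_eq_norm]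
                exact ⟨not_lt.1 hx, ht⟩
        _ ≤ ENNReal.ofReal (heatConst d * (ρ ^ 2)⁻¹) +
            ENNReal.ofReal (heatConst d * (ρ ^ 2)⁻¹) := by
            rw [lintegral_add_left]
            · refine add_le_add (lintegral_singKer_compl_ball_le hε hρ h1)
                (lintegral_singKer_compl_ball_le hε hρ (by simpa using hρ.le))
            · exact ((mK w).comp measurable_prodMk_right).enorm
        _ = _ := by
            rw [← ENNReal.ofReal_add (by positivity) (by positivity), two_mul]
    · refine le_trans ?_ le_add_self
      rcases lt_or_ge t (c.2 - 4 * ρ ^ 2) with hlt | hge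
      · have e : ∀ x : V, singKer ε (x, t) w - singKer ε (x, t) c = 0 := by
          intro x
          have := abs_le.1 h2
          have h3 : ¬ w.2 < t := by nlinarith
          have h4 : ¬ c.2 < t := by nlinarith
          simp [singKer, h3, h4]
        have e' : ∀ x : V, Qᶜ.indicator (fun z => ‖singKer ε z w - singKer ε z c‖ₑ) (x, t) = 0 := by
          intro x
          simp only [indicator, e, enorm_zero, ite_self]
        simp [e']
      · have hgt : c.2 + 4 * ρ ^ 2 < t := by
          by_contra h
          exact ht ⟨hge, not_lt.1 h⟩
        have hσ : 3 * ρ ^ 2 < t - c.2 - ρ ^ 2 := by linarith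
        rw [indicator_of_mem (show t - (c.2 + ρ ^ 2) ∈ Ioi (3 * ρ ^ 2) by
          simp only [mem_Ioi]
          linarith), ← ENNReal.ofReal_mul hc.le, ← sub_sub]
        exact (lintegral_mono fun x => indicator_le_self _ _ _).trans
          (lintegral_singKer_sub_le hε hρ h1 h2 hσ)
  refine (lintegral_mono hslice).trans ?_
  rw [lintegral_add_left (measurable_const.indicator measurableSet_Icc),
    lintegral_const_mul' _ _ ENNReal.ofReal_ne_top, lintegral_indicator measurableSet_Icc,
    setLIntegral_const, Real.volume_Icc, ← ENNReal.ofReal_mul (by positivity)]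
  refine (add_le_add le_rfl (mul_le_mul' le_rfl (lintegral_rpow_sub_indicator_le hρ))).trans ?_
  rw [← ENNReal.ofReal_ofNat 2, ← ENNReal.ofReal_mul hc.le,
    ← ENNReal.ofReal_add (by
      refine mul_nonneg (by positivity) ?_
      nlinarith) (by positivity)]
  apply ENNReal.ofReal_le_ofReal
  apply le_of_eq
  field_simp
  ring

end SingularKernel

section HeatSymbol

open FourierTransform

variable {V : Type*} [NormedAddCommGroup V] [InnerProductSpace ℝ V] [FiniteDimensional ℝ V]
  [MeasurableSpace V] [BorelSpace V]

/-- The Fourier transform of the heat kernel. -/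
theorem integral_fourierChar_smul_heatKer {τ : ℝ} (hτ : 0 < τ) (ξ : V) :
    ∫ x : V, 𝐞 (-inner ℝ x ξ) • (heatKer (Module.finrank ℝ V) (‖x‖ ^ 2) τ : ℂ) =
      (Real.exp (-(4 * Real.pi ^ 2 * ‖ξ‖ ^ 2) * τ) : ℂ) := by
  have hpi := Real.pi_pos
  have h := fourier_gaussian_innerProductSpace (V := V) (b := ((4 * τ)⁻¹ : ℝ))
    (by rw [Complex.ofReal_re]; positivity) ξ
  rw [Real.fourier_eq] at h
  have e : ∀ x : V, 𝐞 (-inner ℝ x ξ) • (heatKer (Module.finrank ℝ V) (‖x‖ ^ 2) τ : ℂ) =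
      ((4 * Real.pi * τ) ^ (-(Module.finrank ℝ V / 2 : ℝ)) : ℝ) *
        (𝐞 (-inner ℝ x ξ) • Complex.exp (-(((4 * τ)⁻¹ : ℝ) : ℂ) * (‖x‖ : ℂ) ^ 2)) := by
    intro x
    rw [mul_smul_comm]
    congr 1
    unfold heatKer
    push_cast
    congr 2
    ring
  simp_rw [e]
  rw [integral_const_mul, h, ← mul_assoc]
  have e2 : ((Real.pi : ℂ) / ((4 * τ)⁻¹ : ℝ)) ^ ((Module.finrank ℝ V : ℂ) / 2) =
      ((4 * Real.pi * τ) ^ (Module.finrank ℝ V / 2 : ℝ) : ℝ) := by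
    rw [Complex.ofReal_cpow (by positivity)]
    push_cast
    congr 1
    field_simp
  rw [e2, ← Complex.ofReal_mul, ← Real.rpow_add (by positivity), neg_add_cancel, Real.rpow_zero,
    Complex.ofReal_one, one_mul]
  push_cast
  congr 1
  have : (τ : ℂ) ≠ 0 := by exact_mod_cast hτ.ne'
  field_simp

theorem heatKer_le_of_mem_ball {d : ℕ} {q τ s : ℝ} (hτ : 0 < τ) (hq : 0 ≤ q)
    (hs : s ∈ ball τ (τ / 2)) :
    heatKer d q (2 * s) ≤ (3 : ℝ) ^ (d / 2 : ℝ) * heatKer d q (3 * τ) := by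
  have hpi := Real.pi_pos
  rw [Real.ball_eq_Ioo] at hs
  have h1 : τ / 2 < s := by linarith [hs.1]
  have h2 : s < 3 * τ / 2 := by linarith [hs.2]
  have hs0 : 0 < s := by linarith
  have e : (3 : ℝ) ^ (d / 2 : ℝ) * heatKer d q (3 * τ) =
      (4 * Real.pi * τ) ^ (-(d / 2 : ℝ)) * Real.exp (-q / (4 * (3 * τ))) := by
    unfold heatKer
    rw [show 4 * Real.pi * (3 * τ) = 3 * (4 * Real.pi * τ) by ring,
      Real.mul_rpow (by norm_num) (by positivity), ← mul_assoc, ← mul_assoc,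
      ← Real.rpow_add (by norm_num)]
    simp
  rw [e]
  unfold heatKer
  have h3 : (4 * Real.pi * (2 * s)) ^ (-(d / 2 : ℝ)) ≤ (4 * Real.pi * τ) ^ (-(d / 2 : ℝ)) := by
    refine Real.rpow_le_rpow_of_nonpos (by positivity) ?_ ?_
    · gcongr
      linarith
    · rw [neg_nonpos]
      positivity
  refine mul_le_mul h3 (Real.exp_le_exp.2 ?_) (by positivity) (by positivity)
  rw [neg_div, neg_div, neg_le_neg_iff]
  exact div_le_div_of_nonneg_left hq (by positivity) (by linarith)

/-- The Fourier transform of the time derivative of the heat kernel. -/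
theorem integral_fourierChar_smul_heatKerDt {τ : ℝ} (hτ : 0 < τ) (ξ : V) :
    ∫ x : V, 𝐞 (-inner ℝ x ξ) • (heatKerDt (Module.finrank ℝ V) (‖x‖ ^ 2) τ : ℂ) =
      (-(4 * Real.pi ^ 2 * ‖ξ‖ ^ 2) * Real.exp (-(4 * Real.pi ^ 2 * ‖ξ‖ ^ 2) * τ) : ℂ) := by
  set d := Module.finrank ℝ V
  have hc := heatConst_pos d
  have mk : ∀ s : ℝ, Measurable fun x : V => heatKer d (‖x‖ ^ 2) s := fun s =>
    (measurable_heatKer d).comp (f := fun x : V => (‖x‖ ^ 2, s)) (by fun_prop)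
  have mkd : ∀ s : ℝ, Measurable fun x : V => heatKerDt d (‖x‖ ^ 2) s := fun s =>
    (measurable_heatKerDt d).comp (f := fun x : V => (‖x‖ ^ 2, s)) (by fun_prop)
  have mch : Continuous fun x : V => 𝐞 (-inner ℝ x ξ) :=
    Real.continuous_fourierChar.comp (by fun_prop)
  have hms : ∀ s, AEStronglyMeasurable
      (fun x : V => 𝐞 (-inner ℝ x ξ) • (heatKer d (‖x‖ ^ 2) s : ℂ)) volume := fun s =>
    mch.aestronglyMeasurable.smul (Complex.measurable_ofReal.comp (mk s)).aestronglyMeasurable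
  have hpos : ∀ s ∈ ball τ (τ / 2), τ / 2 < s := by
    intro s hs
    rw [Real.ball_eq_Ioo] at hs
    linarith [hs.1]
  have hD := (hasDerivAt_integral_of_dominated_loc_of_deriv_le (μ := (volume : Measure V))
    (F := fun s x => 𝐞 (-inner ℝ x ξ) • (heatKer d (‖x‖ ^ 2) s : ℂ))
    (F' := fun s x => 𝐞 (-inner ℝ x ξ) • (heatKerDt d (‖x‖ ^ 2) s : ℂ))
    (bound := fun x => heatConst d * (2 / τ) *
      ((3 : ℝ) ^ (d / 2 : ℝ) * heatKer d (‖x‖ ^ 2) (3 * τ)))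
    (ball_mem_nhds τ (half_pos hτ)) (Filter.Eventually.of_forall hms) ?_ ?_ ?_ ?_ ?_).2
  · have hE : HasDerivAt (fun s : ℝ => (Real.exp (-(4 * Real.pi ^ 2 * ‖ξ‖ ^ 2) * s) : ℂ))
        (-(4 * Real.pi ^ 2 * ‖ξ‖ ^ 2) * Real.exp (-(4 * Real.pi ^ 2 * ‖ξ‖ ^ 2) * τ) : ℂ) τ := by
      have := (((hasDerivAt_id τ).const_mul (-(4 * Real.pi ^ 2 * ‖ξ‖ ^ 2))).exp).ofReal_comp
      refine this.congr_deriv ?_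
      push_cast
      simp
      ring
    refine hD.unique (hE.congr_of_eventuallyEq ?_)
    filter_upwards [lt_mem_nhds hτ] with s hs
    exact integral_fourierChar_smul_heatKer hs ξ
  · refine (integrable_heatKer hτ).mono (hms τ) (Filter.Eventually.of_forall fun x => ?_)
    rw [Circle.norm_smul, Complex.norm_real]
  · exact mch.aestronglyMeasurable.smul
      (Complex.measurable_ofReal.comp (mkd τ)).aestronglyMeasurable
  · refine Filter.Eventually.of_forall fun x s hs => ?_
    have h1 := hpos s hs
    have hs0 : 0 < s := by linarith
    have hk := (heatKer_pos (d := d) (q := ‖x‖ ^ 2) (show 0 < 2 * s by positivity)).le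
    rw [Circle.norm_smul, Complex.norm_real, Real.norm_eq_abs]
    refine (abs_heatKerDt_le' hs0 (by positivity)).trans ?_
    refine mul_le_mul ?_ (heatKer_le_of_mem_ball hτ (by positivity) hs) hk (by positivity)
    refine mul_le_mul (le_heatConst d) ?_ (by positivity) hc.le
    rw [inv_le_comm₀ hs0 (by positivity), inv_div]
    exact h1.le
  · exact ((integrable_heatKer (by positivity)).const_mul _).const_mul _
  · refine Filter.Eventually.of_forall fun x s hs => ?_
    have hs0 : 0 < s := by linarith [hpos s hs]
    have h1 := (hasDerivAt_heatKer (d := d) (hasDerivAt_const s (‖x‖ ^ 2)) (hasDerivAt_id s)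
      hs0).ofReal_comp
    have h2 := h1.const_smul (𝐞 (-inner ℝ x ξ))
    refine h2.congr_deriv ?_
    simp

end HeatSymbol

section SingularKernelL2

open FourierTransform

/-- Schur's test for a convolution with a subprobability density. -/
theorem lintegral_lintegral_mul_sq_le {φ G : ℝ → ℝ≥0∞} (hφ : Measurable φ) (hG : Measurable G)
    (h1 : ∫⁻ r, φ r ≤ 1) :
    ∫⁻ t, (∫⁻ s, φ (t - s) * G s) ^ 2 ≤ ∫⁻ s, G s ^ 2 := by
  have hm : ∀ t : ℝ, Measurable fun s => φ (t - s) := fun t => hφ.comp (by fun_prop)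
  have hpt : ∀ t, (∫⁻ s, φ (t - s) * G s) ^ 2 ≤ ∫⁻ s, φ (t - s) * G s ^ 2 := by
    intro t
    have hH := ENNReal.lintegral_mul_le_Lp_mul_Lq (volume : Measure ℝ) Real.HolderConjugate.two_two
      (f := fun s => φ (t - s) ^ (1 / 2 : ℝ)) (g := fun s => φ (t - s) ^ (1 / 2 : ℝ) * G s)
      ((hm t).pow_const _).aemeasurable (((hm t).pow_const _).mul hG).aemeasurable
    have e1 : ∀ s, φ (t - s) ^ (1 / 2 : ℝ) * (φ (t - s) ^ (1 / 2 : ℝ) * G s) = φ (t - s) * G s := by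
      intro s
      rw [← mul_assoc, ← ENNReal.rpow_add_of_nonneg _ _ (by norm_num) (by norm_num)]
      norm_num
    have e2 : ∀ s, (φ (t - s) ^ (1 / 2 : ℝ) * G s) ^ (2 : ℝ) = φ (t - s) * G s ^ 2 := by
      intro s
      rw [ENNReal.mul_rpow_of_nonneg _ _ (by norm_num), ← ENNReal.rpow_mul]
      norm_num
    have e3 : ∀ s, (φ (t - s) ^ (1 / 2 : ℝ)) ^ (2 : ℝ) = φ (t - s) := by
      intro s
      rw [← ENNReal.rpow_mul]
      norm_num
    simp only [Pi.mul_apply, e1, e2, e3] at hH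
    have h2 : ∫⁻ s, φ (t - s) ≤ 1 := by
      rw [lintegral_sub_left_eq_self φ t]
      exact h1
    have h3 : (∫⁻ s, φ (t - s)) ^ (1 / 2 : ℝ) ≤ 1 := ENNReal.rpow_le_one h2 (by norm_num)
    have h4 : ∫⁻ s, φ (t - s) * G s ≤ (∫⁻ s, φ (t - s) * G s ^ 2) ^ (1 / 2 : ℝ) :=
      hH.trans (mul_le_of_le_one_left zero_le h3)
    calc (∫⁻ s, φ (t - s) * G s) ^ 2 ≤ ((∫⁻ s, φ (t - s) * G s ^ 2) ^ (1 / 2 : ℝ)) ^ 2 := by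
          gcongr
      _ = _ := by
          rw [← ENNReal.rpow_natCast, ← ENNReal.rpow_mul]
          norm_num
  refine (lintegral_mono hpt).trans ?_
  rw [lintegral_lintegral_swap (by fun_prop)]
  refine lintegral_mono fun s => ?_
  have : Measurable fun t => φ (t - s) := hφ.comp (by fun_prop)
  rw [lintegral_mul_const _ this, lintegral_sub_right_eq_self φ s]
  exact mul_le_of_le_one_left zero_le h1

theorem lintegral_indicator_exp_le {a ε : ℝ} (ha : 0 ≤ a) (hε : 0 < ε) :
    ∫⁻ r : ℝ, (Ioi 0).indicator (fun r => ENNReal.ofReal (a * Real.exp (-a * (r + ε)))) r ≤ 1 := by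
  rw [lintegral_indicator measurableSet_Ioi]
  rcases ha.eq_or_lt with rfl | ha
  · simp
  have hi : IntegrableOn (fun r : ℝ => a * Real.exp (-a * r)) (Ioi 0) :=
    (exp_neg_integrableOn_Ioi 0 ha).const_mul _
  calc _ ≤ ∫⁻ r in Ioi (0 : ℝ), ENNReal.ofReal (a * Real.exp (-a * r)) := by
        refine lintegral_mono fun r => ENNReal.ofReal_le_ofReal ?_
        gcongr ?_ * Real.exp ?_
        nlinarith
    _ = ENNReal.ofReal (∫ r in Ioi (0 : ℝ), a * Real.exp (-a * r)) := by
        rw [ofReal_integral_eq_lintegral_ofReal hi]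
        exact Filter.Eventually.of_forall fun r => by positivity
    _ ≤ 1 := by
        rw [integral_const_mul, integral_exp_mul_Ioi (by linarith)]
        simp [ha.ne']

theorem enorm_ofReal (r : ℝ) : ‖(r : ℂ)‖ₑ = ‖r‖ₑ := by
  rw [← ofReal_norm, ← ofReal_norm, Complex.norm_real]

variable {V : Type*} [NormedAddCommGroup V] [InnerProductSpace ℝ V] [FiniteDimensional ℝ V]
  [MeasurableSpace V] [BorelSpace V]

theorem lintegral_enorm_singKer_le {ε : ℝ} (hε : 0 < ε) (t : ℝ) (w : V × ℝ) :
    ∫⁻ x : V, ‖singKer ε (x, t) w‖ₑ ≤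
      ENNReal.ofReal (heatConst (Module.finrank ℝ V) * ε⁻¹) := by
  have hc := heatConst_pos (Module.finrank ℝ V)
  by_cases h : w.2 < t
  · simp only [singKer, h, if_true]
    refine (lintegral_enorm_heatKerDt_le (by linarith) w.1).trans ?_
    refine ENNReal.ofReal_le_ofReal ?_
    gcongr
    linarith
  · simp [singKer, h]

/-- The spatial Fourier transform of `singKer`. -/
theorem integral_fourierChar_smul_singKer {ε : ℝ} (hε : 0 < ε) (t : ℝ) (w : V × ℝ) (ξ : V) :
    ∫ x : V, 𝐞 (-inner ℝ x ξ) • (singKer ε (x, t) w : ℂ) =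
      if w.2 < t then 𝐞 (-inner ℝ w.1 ξ) • (-(4 * Real.pi ^ 2 * ‖ξ‖ ^ 2) *
        Real.exp (-(4 * Real.pi ^ 2 * ‖ξ‖ ^ 2) * (t - w.2 + ε)) : ℂ) else 0 := by
  by_cases h : w.2 < t
  · simp only [singKer, h, if_true]
    rw [← integral_fourierChar_smul_heatKerDt (by linarith) ξ, Circle.smul_def, smul_eq_mul, ← integral_const_mul,
      ← integral_sub_right_eq_self (fun x : V => (𝐞 (-inner ℝ w.1 ξ) : ℂ) * 𝐞 (-inner ℝ x ξ) •
        (heatKerDt (Module.finrank ℝ V) (‖x‖ ^ 2) (t - w.2 + ε) : ℂ)) w.1]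
    congr 1
    ext x
    rw [← smul_eq_mul, ← Circle.smul_def, smul_smul, ← AddChar.map_add_eq_mul]
    congr 2
    rw [inner_sub_left]
    ring
  · simp [singKer, h]

/-- The regularized singular integral operator is a contraction on `L²`. -/
theorem lintegral_enorm_integral_singKer_sq_le {ε : ℝ} (hε : 0 < ε) {g : V × ℝ → ℝ}
    (hg : Measurable g) (hgi : Integrable g) (hgb : ∃ N : ℝ, ∀ z, |g z| ≤ N) :
    ∫⁻ z, ‖∫ w, singKer ε z w * g w‖ₑ ^ 2 ≤ ∫⁻ z, ‖g z‖ₑ ^ 2 := by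
  obtain ⟨N, hN⟩ := hgb
  have mK := measurable_singKer (V := V) ε
  set M := heatConst (Module.finrank ℝ V) * ε⁻¹ *
      (4 * Real.pi * (2 * ε)) ^ (-(Module.finrank ℝ V / 2 : ℝ)) with hM
  have hKM : ∀ z w : V × ℝ, |singKer ε z w| ≤ M := abs_singKer_le hε
  set T : V × ℝ → ℝ := fun z => ∫ w, singKer ε z w * g w with hT
  have mT : Measurable T := by
    have : Measurable fun p : (V × ℝ) × (V × ℝ) => singKer ε p.1 p.2 * g p.2 :=
      mK.mul (hg.comp measurable_snd)
    exact this.stronglyMeasurable.integral_prod_right'.measurable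
  -- for each time the kernel is integrable in the remaining variables
  have hI : ∀ t : ℝ, Integrable (fun p : V × (V × ℝ) => singKer ε (p.1, t) p.2 * g p.2)
      (volume.prod volume) := by
    intro t
    have hm : Measurable fun p : V × (V × ℝ) => singKer ε (p.1, t) p.2 * g p.2 :=
      (mK.comp (f := fun p : V × (V × ℝ) => ((p.1, t), p.2)) (by fun_prop)).mul
        (hg.comp measurable_snd)
    refine ⟨hm.aestronglyMeasurable, ?_⟩
    unfold HasFiniteIntegral
    rw [lintegral_prod_symm' _ hm.enorm]
    calc _ ≤ ∫⁻ w, ENNReal.ofReal (heatConst (Module.finrank ℝ V) * ε⁻¹) * ‖g w‖ₑ := by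
          refine lintegral_mono fun w => ?_
          simp_rw [enorm_mul]
          rw [lintegral_mul_const' _ _ enorm_ne_top]
          exact mul_le_mul' (lintegral_enorm_singKer_le hε t w) le_rfl
      _ < ∞ := by
          rw [lintegral_const_mul' _ _ ENNReal.ofReal_ne_top]
          exact ENNReal.mul_lt_top ENNReal.ofReal_lt_top hgi.2
  have hTi : ∀ t : ℝ, Integrable fun x : V => (T (x, t) : ℂ) := fun t =>
    (hI t).integral_prod_left.ofReal
  have hT2 : ∀ t : ℝ, MemLp (fun x : V => (T (x, t) : ℂ)) 2 := by
    intro t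
    rw [memLp_two_iff_integrable_sq_norm (hTi t).aestronglyMeasurable]
    simp_rw [pow_two]
    refine (hTi t).norm.bdd_mul (c := M * ∫ w, |g w|) (hTi t).aestronglyMeasurable.norm
      (Filter.Eventually.of_forall fun x => ?_)
    rw [norm_norm, Complex.norm_real]
    refine (norm_integral_le_integral_norm _).trans ?_
    rw [← integral_const_mul]
    refine integral_mono_of_nonneg (Filter.Eventually.of_forall fun w => norm_nonneg _)
      (hgi.abs.const_mul _) (Filter.Eventually.of_forall fun w => ?_)
    simp only [norm_mul, Real.norm_eq_abs]
    gcongr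
    exact hKM _ _
  set a : V → ℝ := fun ξ => 4 * Real.pi ^ 2 * ‖ξ‖ ^ 2 with ha
  have ha0 : ∀ ξ, 0 ≤ a ξ := fun ξ => by positivity
  set φ : V → ℝ → ℝ≥0∞ := fun ξ =>
    (Ioi 0).indicator (fun r => ENNReal.ofReal (a ξ * Real.exp (-a ξ * (r + ε)))) with hφ
  set G : V → ℝ → ℂ := fun ξ s => ∫ y : V, 𝐞 (-inner ℝ y ξ) • (g (y, s) : ℂ) with hG
  have cch : Continuous fun p : V × V => (𝐞 (-inner ℝ p.1 p.2) : ℂ) :=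
    continuous_subtype_val.comp (Real.continuous_fourierChar.comp (by fun_prop))
  have mG : Measurable (Function.uncurry G) := by
    have : StronglyMeasurable fun p : (V × ℝ) × V =>
        𝐞 (-inner ℝ p.2 p.1.1) • (g (p.2, p.1.2) : ℂ) := by
      simp only [Circle.smul_def, smul_eq_mul]
      refine StronglyMeasurable.mul ?_ ?_
      · exact (cch.comp
          (f := fun p : (V × ℝ) × V => (p.2, p.1.1)) (by fun_prop)).stronglyMeasurable
      · exact (Complex.measurable_ofReal.comp (hg.comp (by fun_prop))).stronglyMeasurable
    exact this.integral_prod_right'.measurable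
  have hF : ∀ t ξ, ‖𝓕 (fun x : V => (T (x, t) : ℂ)) ξ‖ₑ ≤ ∫⁻ s, φ ξ (t - s) * ‖G ξ s‖ₑ := by
    intro t ξ
    have hsw : 𝓕 (fun x : V => (T (x, t) : ℂ)) ξ =
        ∫ w : V × ℝ, (∫ x : V, 𝐞 (-inner ℝ x ξ) • (singKer ε (x, t) w : ℂ)) * (g w : ℂ) := by
      rw [Real.fourier_eq]
      simp_rw [← integral_mul_const]
      rw [← integral_integral_swap]
      · refine integral_congr_ae (Filter.Eventually.of_forall fun x => ?_)
        simp only [hT]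
        rw [← integral_complex_ofReal, Circle.smul_def, smul_eq_mul, ← integral_const_mul]
        congr 1
        ext w
        rw [Circle.smul_def, smul_eq_mul, Complex.ofReal_mul, mul_assoc]
      · refine (hI t).mono ?_ (Filter.Eventually.of_forall fun p => ?_)
        · refine AEStronglyMeasurable.mul (AEStronglyMeasurable.smul ?_ ?_) ?_
          · exact (cch.comp (f := fun p : V × (V × ℝ) => (p.1, ξ))
              (by fun_prop)).aestronglyMeasurable
          · exact (Complex.measurable_ofReal.comp (mK.comp
              (f := fun p : V × (V × ℝ) => ((p.1, t), p.2))
              (by fun_prop))).aestronglyMeasurable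
          · exact (Complex.measurable_ofReal.comp (hg.comp measurable_snd)).aestronglyMeasurable
        · simp only [Function.uncurry, norm_mul, Circle.norm_smul, Complex.norm_real]
          exact le_rfl
    rw [hsw]
    simp_rw [integral_fourierChar_smul_singKer hε]
    have hInt : Integrable (fun w : V × ℝ => (if w.2 < t then 𝐞 (-inner ℝ w.1 ξ) • (-(a ξ) *
        Real.exp (-(a ξ) * (t - w.2 + ε)) : ℂ) else 0) * (g w : ℂ)) (volume.prod volume) := by
      refine (hgi.const_mul (a ξ)).mono ?_ (Filter.Eventually.of_forall fun w => ?_)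
      · refine AEStronglyMeasurable.mul ?_
          (Complex.measurable_ofReal.comp hg).aestronglyMeasurable
        refine Measurable.aestronglyMeasurable (Measurable.ite
          (measurableSet_lt measurable_snd measurable_const) ?_ measurable_const)
        simp only [Circle.smul_def, smul_eq_mul]
        refine Measurable.mul (cch.comp (f := fun p : V × ℝ => (p.1, ξ))
          (by fun_prop)).measurable (by fun_prop)
      · rw [norm_mul, norm_mul, Complex.norm_real, Real.norm_eq_abs (a ξ), abs_of_nonneg (ha0 ξ)]
        refine mul_le_mul_of_nonneg_right ?_ (norm_nonneg _)
        split_ifs with h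
        · rw [Circle.norm_smul, norm_mul, norm_neg, Complex.norm_real, Complex.norm_real,
            Real.norm_eq_abs (a ξ), abs_of_nonneg (ha0 ξ), Real.norm_eq_abs, Real.abs_exp]
          refine mul_le_of_le_one_right (ha0 ξ) (Real.exp_le_one_iff.2 ?_)
          have := mul_nonneg (ha0 ξ) (show 0 ≤ t - w.2 + ε by linarith)
          linarith
        · rw [norm_zero]
          exact ha0 ξ
    have hpr := integral_prod_symm _ hInt
    rw [← Measure.volume_eq_prod] at hpr
    simp only [ha, Complex.ofReal_mul, Complex.ofReal_pow, Complex.ofReal_ofNat] at hpr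
    rw [hpr]
    refine (enorm_integral_le_lintegral_enorm _).trans (lintegral_mono fun s => ?_)
    by_cases h : s < t
    · simp only [h, if_true, hφ]
      rw [indicator_of_mem (show t - s ∈ Ioi (0 : ℝ) from sub_pos.2 h)]
      have e : ∀ y : V, (𝐞 (-inner ℝ y ξ) • (-(4 * Real.pi ^ 2 * ‖ξ‖ ^ 2) *
          Real.exp (-(4 * Real.pi ^ 2 * ‖ξ‖ ^ 2) * (t - s + ε)) : ℂ)) * (g (y, s) : ℂ) =
          (-(4 * Real.pi ^ 2 * ‖ξ‖ ^ 2) *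
          Real.exp (-(4 * Real.pi ^ 2 * ‖ξ‖ ^ 2) * (t - s + ε)) : ℂ) *
          (𝐞 (-inner ℝ y ξ) • (g (y, s) : ℂ)) := by
        intro y
        rw [smul_mul_assoc, mul_smul_comm]
      simp_rw [e]
      rw [integral_const_mul, enorm_mul]
      refine mul_le_mul' (le_of_eq ?_) le_rfl
      have e2 : (-(4 * Real.pi ^ 2 * ‖ξ‖ ^ 2) *
          Real.exp (-(4 * Real.pi ^ 2 * ‖ξ‖ ^ 2) * (t - s + ε)) : ℂ) =
          ((-(a ξ * Real.exp (-a ξ * (t - s + ε))) : ℝ) : ℂ) := by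
        simp only [ha]
        push_cast
        ring
      have : 0 ≤ a ξ * Real.exp (-a ξ * (t - s + ε)) := mul_nonneg (ha0 ξ) (Real.exp_pos _).le
      rw [e2, ← ofReal_norm, Complex.norm_real, norm_neg, Real.norm_eq_abs,
        abs_of_nonneg this]
    · simp [h]
  have mφ : Measurable (Function.uncurry φ) := by
    have : Function.uncurry φ = (Prod.snd ⁻¹' Ioi (0 : ℝ)).indicator
        fun p : V × ℝ => ENNReal.ofReal (a p.1 * Real.exp (-a p.1 * (p.2 + ε))) := by
      ext p
      simp only [Function.uncurry, hφ, indicator, mem_preimage]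
      split_ifs <;> rfl
    rw [this]
    exact Measurable.indicator (by fun_prop) (measurable_snd measurableSet_Ioi)
  have mg2 : Measurable fun z => ‖g z‖ₑ ^ 2 := by fun_prop
  have mT2 : Measurable fun z => ‖T z‖ₑ ^ 2 := by fun_prop
  have mR : Measurable fun p : V × ℝ => (∫⁻ s, φ p.1 (p.2 - s) * ‖G p.1 s‖ₑ) ^ 2 := by
    have : Measurable fun p : (V × ℝ) × ℝ => φ p.1.1 (p.1.2 - p.2) * ‖G p.1.1 p.2‖ₑ :=
      (mφ.comp (f := fun p : (V × ℝ) × ℝ => (p.1.1, p.1.2 - p.2)) (by fun_prop)).mul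
        (mG.comp (f := fun p : (V × ℝ) × ℝ => (p.1.1, p.2)) (by fun_prop)).enorm
    exact this.lintegral_prod_right'.pow_const 2
  have hgs : ∀ᵐ s : ℝ, Integrable fun y : V => g (y, s) := by
    have := hgi
    rw [Measure.volume_eq_prod] at this
    exact this.prod_left_ae
  calc ∫⁻ z, ‖T z‖ₑ ^ 2 = ∫⁻ t : ℝ, ∫⁻ x : V, ‖(T (x, t) : ℂ)‖ₑ ^ 2 := by
        rw [Measure.volume_eq_prod, lintegral_prod_symm' _ mT2]
        refine lintegral_congr fun t => lintegral_congr fun x => ?_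
        rw [enorm_ofReal]
    _ = ∫⁻ t : ℝ, ∫⁻ ξ : V, ‖𝓕 (fun x : V => (T (x, t) : ℂ)) ξ‖ₑ ^ 2 :=
        lintegral_congr fun t => (lintegral_enorm_fourier_sq (hTi t) (hT2 t)).symm
    _ ≤ ∫⁻ t : ℝ, ∫⁻ ξ : V, (∫⁻ s, φ ξ (t - s) * ‖G ξ s‖ₑ) ^ 2 := by
        refine lintegral_mono fun t => lintegral_mono fun ξ => ?_
        gcongr
        exact hF t ξ
    _ = ∫⁻ ξ : V, ∫⁻ t : ℝ, (∫⁻ s, φ ξ (t - s) * ‖G ξ s‖ₑ) ^ 2 :=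
        lintegral_lintegral_swap (mR.comp measurable_swap).aemeasurable
    _ ≤ ∫⁻ ξ : V, ∫⁻ s : ℝ, ‖G ξ s‖ₑ ^ 2 := by
        refine lintegral_mono fun ξ => lintegral_lintegral_mul_sq_le
          (mφ.comp measurable_prodMk_left) (mG.comp measurable_prodMk_left).enorm
          (lintegral_indicator_exp_le (ha0 ξ) hε)
    _ = ∫⁻ s : ℝ, ∫⁻ ξ : V, ‖G ξ s‖ₑ ^ 2 :=
        lintegral_lintegral_swap (mG.enorm.pow_const 2).aemeasurable
    _ = ∫⁻ s : ℝ, ∫⁻ y : V, ‖g (y, s)‖ₑ ^ 2 := by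
        refine lintegral_congr_ae ?_
        filter_upwards [hgs] with s hs
        have h2 : MemLp (fun y : V => (g (y, s) : ℂ)) 2 := by
          rw [memLp_two_iff_integrable_sq_norm hs.ofReal.aestronglyMeasurable]
          simp_rw [pow_two]
          refine hs.ofReal.norm.bdd_mul (c := N) hs.ofReal.aestronglyMeasurable.norm
            (Filter.Eventually.of_forall fun y => ?_)
          rw [norm_norm, Complex.norm_real]
          exact hN _
        have h := lintegral_enorm_fourier_sq hs.ofReal h2
        simp only [Real.fourier_eq] at h
        refine h.trans (lintegral_congr fun y => ?_)
        exact congrArg (· ^ 2) (enorm_ofReal _)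
    _ = ∫⁻ z, ‖g z‖ₑ ^ 2 := by
        rw [Measure.volume_eq_prod, lintegral_prod_symm' _ mg2]

end SingularKernelL2

section ParabolicDyadic

/-- The index of the parabolic grid cell of side `r` in space and `r ^ 2` in time containing `z`. -/
noncomputable def parabolicLabel (n : ℕ) (r : ℝ) (z : EuclideanSpace ℝ (Fin n) × ℝ) :
    (Fin n → ℤ) × ℤ :=
  (fun i => ⌊z.1 i / r⌋, ⌊z.2 / r ^ 2⌋)

theorem floor_div_natCast_mul_eq {K : ℕ} {r x y : ℝ} (h : ⌊x / r⌋ = ⌊y / r⌋) :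
    ⌊x / (K * r)⌋ = ⌊y / (K * r)⌋ := by
  rw [mul_comm, ← div_div, ← div_div, Int.floor_div_natCast, Int.floor_div_natCast, h]

theorem abs_sub_le_of_floor_div_eq {r x y : ℝ} (hr : 0 < r) (h : ⌊x / r⌋ = ⌊y / r⌋) :
    |x - y| ≤ r := by
  have := (Int.abs_sub_lt_one_of_floor_eq_floor h).le
  rwa [← sub_div, abs_div, abs_of_pos hr, div_le_one hr] at this

theorem setOf_floor_div_eq {r : ℝ} (hr : 0 < r) (m : ℤ) :
    {x : ℝ | ⌊x / r⌋ = m} = Ico (m * r) ((m + 1) * r) := by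
  ext x
  rw [mem_ofPred_eq, Int.floor_eq_iff, le_div_iff₀ hr, div_lt_iff₀ hr, mem_Ico]

theorem parabolicLabel_two_mul {n : ℕ} {r : ℝ} {x y : EuclideanSpace ℝ (Fin n) × ℝ}
    (h : parabolicLabel n r x = parabolicLabel n r y) :
    parabolicLabel n (2 * r) x = parabolicLabel n (2 * r) y := by
  simp only [parabolicLabel, Prod.mk.injEq, funext_iff] at h ⊢
  refine ⟨fun i => ?_, ?_⟩
  · exact_mod_cast floor_div_natCast_mul_eq (K := 2) (h.1 i)
  · have := floor_div_natCast_mul_eq (K := 4) h.2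
    rw [show (2 * r) ^ 2 = ((4 : ℕ) : ℝ) * r ^ 2 by push_cast; ring]
    exact this

theorem norm_sub_le_of_parabolicLabel_eq {n : ℕ} {r : ℝ} (hr : 0 < r)
    {x y : EuclideanSpace ℝ (Fin n) × ℝ} (h : parabolicLabel n r x = parabolicLabel n r y) :
    ‖x.1 - y.1‖ ≤ √n * r := by
  simp only [parabolicLabel, Prod.mk.injEq, funext_iff] at h
  rw [EuclideanSpace.norm_eq]
  calc √(∑ i, ‖(x.1 - y.1) i‖ ^ 2) ≤ √(∑ _i : Fin n, r ^ 2) := by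
        gcongr with i
        exact abs_sub_le_of_floor_div_eq hr (h.1 i)
    _ = √n * r := by
        rw [Finset.sum_const, Finset.card_univ, Fintype.card_fin, nsmul_eq_mul,
          Real.sqrt_mul (Nat.cast_nonneg n), Real.sqrt_sq hr.le]

theorem abs_sub_le_of_parabolicLabel_eq {n : ℕ} {r : ℝ} (hr : 0 < r)
    {x y : EuclideanSpace ℝ (Fin n) × ℝ} (h : parabolicLabel n r x = parabolicLabel n r y) :
    |x.2 - y.2| ≤ r ^ 2 :=
  abs_sub_le_of_floor_div_eq (by positivity) (congrArg Prod.snd h)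

theorem setOf_parabolicLabel_eq {n : ℕ} {r : ℝ} (hr : 0 < r) (q : (Fin n → ℤ) × ℤ) :
    {z | parabolicLabel n r z = q} =
      (WithLp.ofLp ⁻¹' univ.pi fun i => Ico (q.1 i * r) ((q.1 i + 1) * r) :
        Set (EuclideanSpace ℝ (Fin n))) ×ˢ Ico (q.2 * r ^ 2) ((q.2 + 1) * r ^ 2) := by
  ext z
  rw [← setOf_floor_div_eq (by positivity)]
  simp_rw [← setOf_floor_div_eq hr]
  simp [parabolicLabel, Prod.ext_iff, funext_iff]

theorem measurableSet_parabolicLabel {n : ℕ} {r : ℝ} (hr : 0 < r) (q : (Fin n → ℤ) × ℤ) :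
    MeasurableSet {z | parabolicLabel n r z = q} := by
  rw [setOf_parabolicLabel_eq hr]
  refine MeasurableSet.prod ?_ measurableSet_Ico
  exact (MeasurableSet.univ_pi fun i => measurableSet_Ico).preimage
    (PiLp.volume_preserving_ofLp (Fin n)).measurable

theorem volume_parabolicLabel {n : ℕ} {r : ℝ} (hr : 0 < r) (q : (Fin n → ℤ) × ℤ) :
    volume {z | parabolicLabel n r z = q} = ENNReal.ofReal (r ^ (n + 2)) := by
  rw [setOf_parabolicLabel_eq hr, Measure.volume_eq_prod, Measure.prod_prod,
    (PiLp.volume_preserving_ofLp (Fin n)).measure_preimage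
      (MeasurableSet.univ_pi fun i => measurableSet_Ico).nullMeasurableSet, volume_pi_pi]
  simp_rw [Real.volume_Ico, add_mul, one_mul, add_sub_cancel_left]
  rw [Finset.prod_const, Finset.card_univ, Fintype.card_fin, ← ENNReal.ofReal_pow hr.le,
    ← ENNReal.ofReal_mul (by positivity), pow_add]

/-- The parabolic dyadic grids of side `2 ^ N * (1 / 2) ^ j`. -/
theorem dyadicSystem_parabolicLabel (n N : ℕ) :
    DyadicSystem (volume : Measure (EuclideanSpace ℝ (Fin n) × ℝ))
      (fun j => parabolicLabel n (2 ^ N * (1 / 2) ^ j))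
      (fun j => (2 ^ N * (1 / 2) ^ j) ^ (n + 2)) (2 ^ (n + 2)) where
  measurableSet_cell j := measurableSet_parabolicLabel (by positivity)
  nested j x y h := by
    have := parabolicLabel_two_mul h
    rwa [show (2 : ℝ) * (2 ^ N * (1 / 2) ^ (j + 1)) = 2 ^ N * (1 / 2) ^ j by ring] at this
  vol_pos j := by positivity
  measure_cell j := volume_parabolicLabel (by positivity)
  vol_le j := by
    rw [← mul_pow, show (2 : ℝ) * (2 ^ N * (1 / 2) ^ (j + 1)) = 2 ^ N * (1 / 2) ^ j by ring]
  one_le := one_le_pow₀ (by norm_num)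

theorem exists_forall_parabolicLabel_eq {n N : ℕ} {F : EuclideanSpace ℝ (Fin n) × ℝ → ℝ}
    (hF : Continuous F) (x : EuclideanSpace ℝ (Fin n) × ℝ) {ε : ℝ} (hε : 0 < ε)
    (hx : (univ ×ˢ Ico 0 1).indicator F x ≠ 0) :
    ∃ j : ℕ, ∀ y, parabolicLabel n (2 ^ N * (1 / 2) ^ j) y =
      parabolicLabel n (2 ^ N * (1 / 2) ^ j) x →
        |(univ ×ˢ Ico 0 1).indicator F y - (univ ×ˢ Ico 0 1).indicator F x| < ε := by
  have hxs := mem_of_indicator_ne_zero hx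
  obtain ⟨δ, hδ, h⟩ := Metric.continuousAt_iff.1 hF.continuousAt ε hε
  have hlim : Filter.Tendsto (fun j : ℕ => (2 : ℝ) ^ N * (1 / 2) ^ j) Filter.atTop (nhds 0) := by
    simpa using (tendsto_pow_atTop_nhds_zero_of_lt_one (r := (1 / 2 : ℝ)) (by norm_num)
      (by norm_num)).const_mul (2 ^ N)
  have h1 : Filter.Tendsto (fun j : ℕ => √n * ((2 : ℝ) ^ N * (1 / 2) ^ j)) Filter.atTop
      (nhds 0) := by simpa using hlim.const_mul (√n)
  have h2 : Filter.Tendsto (fun j : ℕ => ((2 : ℝ) ^ N * (1 / 2) ^ j) ^ 2) Filter.atTop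
      (nhds 0) := by simpa using hlim.pow 2
  obtain ⟨j, hj1, hj2, hj⟩ := ((h1.eventually_lt_const hδ).and
    ((h2.eventually_lt_const hδ).and (Filter.eventually_ge_atTop N))).exists
  refine ⟨j, fun y hy => ?_⟩
  have hr : (0 : ℝ) < 2 ^ N * (1 / 2) ^ j := by positivity
  have hN := congrArg Prod.snd ((dyadicSystem_parabolicLabel n N).label_eq_of_le hj hy)
  have e : (2 : ℝ) ^ N * (1 / 2) ^ N = 1 := by rw [← mul_pow]; norm_num
  simp only [parabolicLabel, e, one_pow, div_one] at hN
  have hx0 : ⌊x.2⌋ = 0 := Int.floor_eq_zero_iff.2 hxs.2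
  have hys : y ∈ (univ : Set (EuclideanSpace ℝ (Fin n))) ×ˢ Ico (0 : ℝ) 1 :=
    ⟨mem_univ _, Int.floor_eq_zero_iff.1 (hN.trans hx0)⟩
  rw [indicator_of_mem hxs, indicator_of_mem hys]
  refine h ?_
  rw [Prod.dist_eq, max_lt_iff, dist_eq_norm, dist_eq_norm]
  exact ⟨(norm_sub_le_of_parabolicLabel_eq hr hy).trans_lt hj1,
    (abs_sub_le_of_parabolicLabel_eq hr hy).trans_lt hj2⟩

/-- The constant relating the cells of the parabolic grid to the cylinders of
`lintegral_singKer_hormander`. -/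
noncomputable def cylinderConst (n : ℕ) : ℝ≥0∞ :=
  ENNReal.ofReal ((2 * √n) ^ n * (8 * n)) * volume (ball (0 : EuclideanSpace ℝ (Fin n)) 1) +
    ENNReal.ofReal (18 * heatConst n)

theorem cylinderConst_ne_top (n : ℕ) : cylinderConst n ≠ ∞ :=
  ENNReal.add_ne_top.2 ⟨ENNReal.mul_ne_top ENNReal.ofReal_ne_top measure_ball_lt_top.ne,
    ENNReal.ofReal_ne_top⟩

/-- Uniform `Lᵖ` bound, `1 < p < 2`, for the regularized singular integrals on the strip. -/
theorem exists_lintegral_singKer_rpow_le {n : ℕ} (hn : 1 ≤ n) {p : ℝ} (hp₁ : 1 < p)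
    (hp₂ : p < 2) :
    ∃ C : ℝ≥0∞, C ≠ ∞ ∧ ∀ F : EuclideanSpace ℝ (Fin n) × ℝ → ℝ, Continuous F →
      HasCompactSupport F → ∀ ε > 0,
        ∫⁻ z, ENNReal.ofReal (|∫ w, singKer ε z w * (univ ×ˢ Ico 0 1).indicator F w| ^ p) ≤
          C * ∫⁻ z in univ ×ˢ Ico 0 1, ENNReal.ofReal (|F z| ^ p) := by
  refine ⟨ENNReal.ofReal (2 ^ p) * (ENNReal.ofReal p * (1 * ENNReal.ofReal (1 / p + 1 / (2 - p)) +
    (ENNReal.ofReal (4 * 2 ^ (n + 2)) + 5 * cylinderConst n) * ENNReal.ofReal (1 / (p - 1)))),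
    ?_, fun F hF hFc ε hε => ?_⟩
  · have := cylinderConst_ne_top n
    finiteness
  · have hS : MeasurableSet ((univ : Set (EuclideanSpace ℝ (Fin n))) ×ˢ Ico (0 : ℝ) 1) :=
      MeasurableSet.univ.prod measurableSet_Ico
    have key := lintegral_abs_integral_kernel_rpow_le (measurable_singKer ε) (abs_singKer_le hε)
      (fun g => lintegral_enorm_integral_singKer_sq_le hε) (D := 2 ^ (n + 2))
      (I := (Fin n → ℤ) × ℤ) (B := cylinderConst n)
      (f := (univ ×ˢ Ico 0 1).indicator F) (μ := (volume : Measure (EuclideanSpace ℝ (Fin n) × ℝ)))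
      ?_ (hF.measurable.indicator hS) ((hF.integrable_of_hasCompactSupport hFc).indicator hS)
      hp₁ hp₂
    · refine key.trans (le_of_eq ?_)
      congr 1
      rw [← lintegral_indicator hS]
      refine lintegral_congr fun z => ?_
      by_cases hz : z ∈ (univ : Set (EuclideanSpace ℝ (Fin n))) ×ˢ Ico (0 : ℝ) 1
      · rw [indicator_of_mem hz, indicator_of_mem hz]
      · rw [indicator_of_notMem hz, indicator_of_notMem hz, abs_zero,
          Real.zero_rpow (by linarith), ENNReal.ofReal_zero]
    · intro V
      obtain ⟨N, hN⟩ := pow_unbounded_of_one_lt V one_lt_two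
      refine ⟨_, _, dyadicSystem_parabolicLabel n N, ?_, ?_, fun x ε hε hx =>
        exists_forall_parabolicLabel_eq hF x hε hx⟩
      · rw [pow_zero, mul_one]
        exact hN.le.trans (le_self_pow₀ (one_le_pow₀ (by norm_num)) (by omega))
      · rintro ⟨j, i⟩
        have hr : (0 : ℝ) < 2 ^ N * (1 / 2) ^ j := by positivity
        have hv := volume_parabolicLabel hr i
        dsimp only
        set r : ℝ := 2 ^ N * (1 / 2) ^ j
        obtain ⟨c, hc⟩ : {z | parabolicLabel n r z = i}.Nonempty := by
          refine nonempty_of_measure_ne_zero (μ := volume) ?_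
          rw [hv]
          exact (ENNReal.ofReal_pos.2 (by positivity)).ne'
        have hn1 : (1 : ℝ) ≤ n := by exact_mod_cast hn
        have hs : (0 : ℝ) < √n := by positivity
        have hss : √(n : ℝ) ^ 2 = n := Real.sq_sqrt (by linarith)
        have hρ : 0 < √n * r := by positivity
        refine ⟨c, closedBall c.1 (2 * (√n * r)) ×ˢ
          Icc (c.2 - 4 * (√n * r) ^ 2) (c.2 + 4 * (√n * r) ^ 2),
          isClosed_closedBall.measurableSet.prod measurableSet_Icc, ?_, fun w hw => ?_⟩
        · rw [hv, Measure.volume_eq_prod, Measure.prod_prod,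
            Measure.addHaar_closedBall _ _ (by positivity), finrank_euclideanSpace_fin,
            Real.volume_Icc, cylinderConst, add_mul]
          refine le_trans (le_of_eq ?_) le_self_add
          rw [mul_right_comm, mul_right_comm _ (volume _), ← ENNReal.ofReal_mul (by positivity),
            ← ENNReal.ofReal_mul (by positivity)]
          congr 2
          rw [mul_pow √(n : ℝ) r 2, hss]
          ring
        · refine (lintegral_singKer_hormander hε hρ ?_ ?_).trans ?_
          · exact norm_sub_le_of_parabolicLabel_eq hr (hw.trans hc.symm)
          · refine (abs_sub_le_of_parabolicLabel_eq hr (hw.trans hc.symm)).trans ?_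
            rw [mul_pow √(n : ℝ) r 2, hss]
            nlinarith [sq_nonneg r]
          · rw [finrank_euclideanSpace_fin, cylinderConst]
            exact le_add_self

end ParabolicDyadic

section DirectionalDerivative

variable {F : Type*} [NormedAddCommGroup F] [NormedSpace ℝ F] {u : F → ℝ}

theorem contDiff_fderiv_apply (hu : ContDiff ℝ (⊤ : ℕ∞) u) (v : F) :
    ContDiff ℝ (⊤ : ℕ∞) fun z => fderiv ℝ u z v :=
  (hu.fderiv_right (m := (⊤ : ℕ∞)) (by simp)).clm_apply contDiff_const

theorem hasCompactSupport_fderiv_apply (hu : HasCompactSupport u) (v : F) :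
    HasCompactSupport fun z => fderiv ℝ u z v :=
  (hu.fderiv ℝ).comp_left (g := fun L : F →L[ℝ] ℝ => L v) rfl

theorem fderiv_fderiv_apply_comm (hu : ContDiff ℝ (⊤ : ℕ∞) u) (v w z : F) :
    fderiv ℝ (fun y => fderiv ℝ u y v) z w = fderiv ℝ (fun y => fderiv ℝ u y w) z v := by
  have h1 : DifferentiableAt ℝ (fderiv ℝ u) z :=
    ((hu.fderiv_right (m := (⊤ : ℕ∞)) (by simp)).differentiable (by simp)) z
  have h2 : IsSymmSndFDerivAt ℝ u z := hu.contDiffAt.isSymmSndFDerivAt (by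
    rw [minSmoothness_of_isRCLikeNormedField]
    exact WithTop.coe_le_coe.2 (le_top : (2 : ℕ∞) ≤ ⊤))
  rw [fderiv_clm_apply h1 (differentiableAt_const _), fderiv_clm_apply h1 (differentiableAt_const _)]
  simpa using h2.eq w v

end DirectionalDerivative

section Duhamel

variable {n : ℕ} {u : EuclideanSpace ℝ (Fin n) × ℝ → ℝ}

theorem contDiff_pdx (hu : ContDiff ℝ (⊤ : ℕ∞) u) (i : Fin n) :
    ContDiff ℝ (⊤ : ℕ∞) (pdx i u) := contDiff_fderiv_apply hu _

theorem contDiff_pdt (hu : ContDiff ℝ (⊤ : ℕ∞) u) : ContDiff ℝ (⊤ : ℕ∞) (pdt u) :=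
  contDiff_fderiv_apply hu _

theorem hasCompactSupport_pdx (hu : HasCompactSupport u) (i : Fin n) :
    HasCompactSupport (pdx i u) := hasCompactSupport_fderiv_apply hu _

theorem hasCompactSupport_pdt (hu : HasCompactSupport u) : HasCompactSupport (pdt u) :=
  hasCompactSupport_fderiv_apply hu _

theorem contDiff_lapP (hu : ContDiff ℝ (⊤ : ℕ∞) u) : ContDiff ℝ (⊤ : ℕ∞) (lapP u) := by
  unfold lapP hessEntryP
  exact ContDiff.sum fun i _ => contDiff_pdx (contDiff_pdx hu i) i

theorem hasCompactSupport_lapP (hu : HasCompactSupport u) : HasCompactSupport (lapP u) := by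
  have : lapP u = ∑ i, hessEntryP u i i := by ext z; simp [lapP]
  rw [this]
  exact Finset.sum_induction _ HasCompactSupport (fun _ _ => HasCompactSupport.add)
    HasCompactSupport.zero fun i _ => hasCompactSupport_pdx (hasCompactSupport_pdx hu i) i

theorem pdt_lapP (hu : ContDiff ℝ (⊤ : ℕ∞) u) : pdt (lapP u) = lapP (pdt u) := by
  ext z
  unfold lapP hessEntryP
  rw [pdt, fderiv_fun_sum fun i _ =>
    ((contDiff_pdx (contDiff_pdx hu i) i).differentiable (by simp)) z]
  rw [_root_.sum_apply]
  refine Finset.sum_congr rfl fun i _ => ?_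
  have h : ∀ w : EuclideanSpace ℝ (Fin n) × ℝ → ℝ, ContDiff ℝ (⊤ : ℕ∞) w →
      pdt (pdx i w) = pdx i (pdt w) := fun w hw => funext fun z =>
    fderiv_fderiv_apply_comm hw _ _ _
  exact congrFun ((h _ (contDiff_pdx hu i)).trans (congrArg (pdx i) (h _ hu))) z

/-- The spatial derivatives of a function vanishing at time `0` vanish at time `0`. -/
theorem pdx_eq_zero (h0 : ∀ x, u (x, 0) = 0) (hu : ContDiff ℝ (⊤ : ℕ∞) u) (i : Fin n)
    (x : EuclideanSpace ℝ (Fin n)) : pdx i u (x, 0) = 0 := by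
  have h := (hu.differentiable (by simp) (x, 0)).hasFDerivAt.hasLineDerivAt
    (EuclideanSpace.single i 1, 0)
  have h2 : HasLineDerivAt ℝ u 0 (x, 0) (EuclideanSpace.single i 1, 0) := by
    unfold HasLineDerivAt
    simpa [h0] using hasDerivAt_const (0 : ℝ) (0 : ℝ)
  exact h.unique h2

theorem lapP_eq_zero (h0 : ∀ x, u (x, 0) = 0) (hu : ContDiff ℝ (⊤ : ℕ∞) u)
    (x : EuclideanSpace ℝ (Fin n)) : lapP u (x, 0) = 0 :=
  Finset.sum_eq_zero fun i _ => pdx_eq_zero (pdx_eq_zero h0 hu i) (contDiff_pdx hu i) i x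

theorem hasLineDerivAt_pdx (hu : ContDiff ℝ (⊤ : ℕ∞) u) (i : Fin n) (s : ℝ)
    (y : EuclideanSpace ℝ (Fin n)) :
    HasLineDerivAt ℝ (fun y => u (y, s)) (pdx i u (y, s)) y (EuclideanSpace.single i 1) := by
  have h := (hu.differentiable (by simp) (y, s)).hasFDerivAt.hasLineDerivAt
    (EuclideanSpace.single i 1, 0)
  unfold HasLineDerivAt at h ⊢
  simpa [pdx] using h

theorem hasDerivAt_norm_sub_sq (x y : EuclideanSpace ℝ (Fin n)) (i : Fin n) :
    HasDerivAt (fun θ : ℝ => ‖x - (y + θ • EuclideanSpace.single i (1 : ℝ))‖ ^ 2)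
      (-(2 * (x i - y i))) 0 := by
  have h : HasDerivAt (fun θ : ℝ => x - (y + θ • EuclideanSpace.single i (1 : ℝ)))
      (-EuclideanSpace.single i (1 : ℝ)) 0 := by
    simpa using (((hasDerivAt_id (0 : ℝ)).smul_const
      (EuclideanSpace.single i (1 : ℝ))).const_add y).const_sub x
  have h2 := h.norm_sq
  simp only [zero_smul, add_zero, inner_neg_right] at h2
  convert h2 using 1
  simp [EuclideanSpace.inner_single_right]
  ring

theorem hasLineDerivAt_heatKer {τ : ℝ} (hτ : 0 < τ) (x y : EuclideanSpace ℝ (Fin n)) (i : Fin n) :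
    HasLineDerivAt ℝ (fun y => heatKer n (‖x - y‖ ^ 2) τ)
      ((x i - y i) / (2 * τ) * heatKer n (‖x - y‖ ^ 2) τ) y (EuclideanSpace.single i 1) := by
  have h := hasDerivAt_heatKer (d := n) (hasDerivAt_norm_sub_sq x y i) (hasDerivAt_const (0 : ℝ) τ)
    hτ
  simp only [zero_smul, add_zero, zero_mul] at h
  unfold HasLineDerivAt
  refine HasDerivAt.congr_deriv h ?_
  have := hτ.ne'
  field_simp
  ring

theorem hasLineDerivAt_mul_heatKer {τ : ℝ} (hτ : 0 < τ) (x y : EuclideanSpace ℝ (Fin n))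
    (i : Fin n) :
    HasLineDerivAt ℝ (fun y => (x i - y i) / (2 * τ) * heatKer n (‖x - y‖ ^ 2) τ)
      (((x i - y i) ^ 2 / (4 * τ ^ 2) - 1 / (2 * τ)) * heatKer n (‖x - y‖ ^ 2) τ) y
      (EuclideanSpace.single i 1) := by
  have h : HasDerivAt (fun θ : ℝ => (x i - (y + θ • EuclideanSpace.single i (1 : ℝ)) i) / (2 * τ))
      (-1 / (2 * τ)) 0 := by
    have : HasDerivAt (fun θ : ℝ => (x i - (y i + θ)) / (2 * τ)) (-1 / (2 * τ)) 0 :=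
      (((hasDerivAt_id (0 : ℝ)).const_add (y i)).const_sub (x i)).div_const _
    simpa using this
  have h2 := h.mul (hasLineDerivAt_heatKer hτ x y i)
  unfold HasLineDerivAt
  refine HasDerivAt.congr_deriv h2 ?_
  simp only [zero_smul, add_zero]
  have := hτ.ne'
  field_simp
  ring

theorem continuous_heatKer_norm_sub {τ : ℝ} (x : EuclideanSpace ℝ (Fin n)) :
    Continuous fun y => heatKer n (‖x - y‖ ^ 2) τ := by
  unfold heatKer
  fun_prop

theorem integrable_mul_section {g : EuclideanSpace ℝ (Fin n) → ℝ} (hg : Continuous g)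
    (hu : Continuous u) (hc : HasCompactSupport u) (s : ℝ) :
    Integrable fun y => g y * u (y, s) := by
  have h : HasCompactSupport fun y => u (y, s) :=
    HasCompactSupport.intro (hc.isCompact.image continuous_fst) fun y hy =>
      image_eq_zero_of_notMem_tsupport fun h => hy ⟨_, h, rfl⟩
  exact (hg.mul (hu.comp (by fun_prop))).integrable_of_hasCompactSupport h.mul_left

/-- Integration by parts in space of the Laplacian against the heat kernel. -/
theorem integral_heatKer_mul_lapP (hu : ContDiff ℝ (⊤ : ℕ∞) u) (hc : HasCompactSupport u)
    {τ : ℝ} (hτ : 0 < τ) (x : EuclideanSpace ℝ (Fin n)) (s : ℝ) :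
    ∫ y, heatKer n (‖x - y‖ ^ 2) τ * lapP u (y, s) =
      ∫ y, heatKerDt n (‖x - y‖ ^ 2) τ * u (y, s) := by
  have cG := continuous_heatKer_norm_sub (τ := τ) x
  have cG1 : ∀ i, Continuous fun y : EuclideanSpace ℝ (Fin n) =>
      (x i - y i) / (2 * τ) * heatKer n (‖x - y‖ ^ 2) τ := fun i => by fun_prop
  have cG2 : ∀ i, Continuous fun y : EuclideanSpace ℝ (Fin n) =>
      ((x i - y i) ^ 2 / (4 * τ ^ 2) - 1 / (2 * τ)) * heatKer n (‖x - y‖ ^ 2) τ :=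
    fun i => by fun_prop
  have key : ∀ i, ∫ y, heatKer n (‖x - y‖ ^ 2) τ * hessEntryP u i i (y, s) =
      ∫ y, ((x i - y i) ^ 2 / (4 * τ ^ 2) - 1 / (2 * τ)) * heatKer n (‖x - y‖ ^ 2) τ *
        u (y, s) := by
    intro i
    have hu1 := contDiff_pdx hu i
    have hc1 := hasCompactSupport_pdx hc i
    have hu2 := contDiff_pdx hu1 i
    have hc2 := hasCompactSupport_pdx hc1 i
    have e1 := integral_bilinear_hasLineDerivAt_right_eq_neg_left_of_integrable
      (B := ContinuousLinearMap.mul ℝ ℝ) (μ := volume)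
      (integrable_mul_section (cG1 i) hu1.continuous hc1 s)
      (integrable_mul_section cG hu2.continuous hc2 s)
      (integrable_mul_section cG hu1.continuous hc1 s)
      (fun y _ => hasLineDerivAt_heatKer hτ x y i) (fun y _ => hasLineDerivAt_pdx hu1 i s y)
    have e2 := integral_bilinear_hasLineDerivAt_right_eq_neg_left_of_integrable
      (B := ContinuousLinearMap.mul ℝ ℝ) (μ := volume)
      (integrable_mul_section (cG2 i) hu.continuous hc s)
      (integrable_mul_section (cG1 i) hu1.continuous hc1 s)
      (integrable_mul_section (cG1 i) hu.continuous hc s)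
      (fun y _ => hasLineDerivAt_mul_heatKer hτ x y i) (fun y _ => hasLineDerivAt_pdx hu i s y)
    simp only [ContinuousLinearMap.mul_apply'] at e1 e2
    unfold hessEntryP
    rw [e1, e2, neg_neg]
  have hq : ∀ y, ‖x - y‖ ^ 2 = ∑ i, (x i - y i) ^ 2 := fun y => by
    rw [EuclideanSpace.real_norm_sq_eq]; rfl
  calc _ = ∫ y, ∑ i, heatKer n (‖x - y‖ ^ 2) τ * pdx i (pdx i u) (y, s) := by
        simp only [lapP, Finset.mul_sum, hessEntryP]
    _ = ∑ i, ∫ y, ((x i - y i) ^ 2 / (4 * τ ^ 2) - 1 / (2 * τ)) * heatKer n (‖x - y‖ ^ 2) τ *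
        u (y, s) := by
        rw [integral_finsetSum _ fun i _ => integrable_mul_section cG
          (contDiff_pdx (contDiff_pdx hu i) i).continuous
          (hasCompactSupport_pdx (hasCompactSupport_pdx hc i) i) s]
        exact Finset.sum_congr rfl fun i _ => key i
    _ = _ := by
        rw [← integral_finsetSum _ fun i _ => integrable_mul_section (cG2 i) hu.continuous hc s]
        congr 1
        ext y
        rw [← Finset.sum_mul, ← Finset.sum_mul, Finset.sum_sub_distrib, ← Finset.sum_div, ← hq,
          heatKerDt]
        simp
        left; left
        ring

end Duhamel

section DuhamelFormula

variable {n : ℕ} {u : EuclideanSpace ℝ (Fin n) × ℝ → ℝ}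

theorem hasDerivAt_pdt (hu : ContDiff ℝ (⊤ : ℕ∞) u) (y : EuclideanSpace ℝ (Fin n)) (s : ℝ) :
    HasDerivAt (fun s => u (y, s)) (pdt u (y, s)) s :=
  (hu.differentiable (by simp) (y, s)).hasFDerivAt.comp_hasDerivAt s
    ((hasDerivAt_const s y).prodMk (hasDerivAt_id s))

theorem continuous_heatKerDt_norm_sub {τ : ℝ} (x : EuclideanSpace ℝ (Fin n)) :
    Continuous fun y => heatKerDt n (‖x - y‖ ^ 2) τ := by
  unfold heatKerDt
  exact Continuous.mul (by fun_prop) (continuous_heatKer_norm_sub x)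

/-- The time derivative of `heatKer n (‖x - y‖ ^ 2) (t - s + ε) * v (y, s)`. -/
noncomputable def duhamelDensity (v : EuclideanSpace ℝ (Fin n) × ℝ → ℝ) (ε : ℝ)
    (z w : EuclideanSpace ℝ (Fin n) × ℝ) : ℝ :=
  heatKer n (‖z.1 - w.1‖ ^ 2) (z.2 - w.2 + ε) * pdt v w -
    heatKerDt n (‖z.1 - w.1‖ ^ 2) (z.2 - w.2 + ε) * v w

theorem continuousOn_duhamelDensity (hu : ContDiff ℝ (⊤ : ℕ∞) u) {ε : ℝ} (hε : 0 < ε)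
    (z : EuclideanSpace ℝ (Fin n) × ℝ) :
    ContinuousOn (duhamelDensity u ε z) (univ ×ˢ Iic z.2) := by
  intro w hw
  have hw2 : w.2 ≤ z.2 := hw.2
  have hpos : 0 < z.2 - w.2 + ε := by linarith
  have hc : ContinuousAt (fun w : EuclideanSpace ℝ (Fin n) × ℝ =>
      (‖z.1 - w.1‖ ^ 2, z.2 - w.2 + ε)) w := by fun_prop
  have h1 := ContinuousAt.comp (f := fun w : EuclideanSpace ℝ (Fin n) × ℝ =>
      (‖z.1 - w.1‖ ^ 2, z.2 - w.2 + ε)) (x := w)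
      (contDiffAt_heatKer (d := n) hpos (m := 0)).continuousAt hc
  have h2 := ContinuousAt.comp (f := fun w : EuclideanSpace ℝ (Fin n) × ℝ =>
      (‖z.1 - w.1‖ ^ 2, z.2 - w.2 + ε)) (x := w)
      (contDiffAt_heatKerDt (d := n) hpos (m := 0)).continuousAt hc
  exact ((h1.mul (contDiff_pdt hu).continuous.continuousAt).sub
    (h2.mul hu.continuous.continuousAt)).continuousWithinAt

theorem intervalIntegral_duhamelDensity (hu : ContDiff ℝ (⊤ : ℕ∞) u) (h0 : ∀ x, u (x, 0) = 0)
    {ε t : ℝ} (hε : 0 < ε) (ht : 0 ≤ t) (x y : EuclideanSpace ℝ (Fin n)) :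
    ∫ s in 0..t, duhamelDensity u ε (x, t) (y, s) = heatKer n (‖x - y‖ ^ 2) ε * u (y, t) := by
  have hd : ∀ s ∈ uIcc 0 t, HasDerivAt (fun s => heatKer n (‖x - y‖ ^ 2) (t - s + ε) * u (y, s))
      (duhamelDensity u ε (x, t) (y, s)) s := by
    intro s hs
    rw [uIcc_of_le ht] at hs
    have h := (hasDerivAt_heatKer (d := n) (hasDerivAt_const s (‖x - y‖ ^ 2))
      (((hasDerivAt_id s).const_sub t).add_const ε)
      (show 0 < t - s + ε by linarith [hs.2])).mul (hasDerivAt_pdt hu y s)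
    refine HasDerivAt.congr_deriv h ?_
    simp only [duhamelDensity, id]
    ring
  rw [intervalIntegral.integral_eq_sub_of_hasDerivAt hd]
  · simp [h0]
  · refine ContinuousOn.intervalIntegrable ((continuousOn_duhamelDensity hu hε (x, t)).comp
      (f := fun s => (y, s)) (by fun_prop) fun s hs => ?_)
    rw [uIcc_of_le ht] at hs
    exact ⟨mem_univ _, hs.2⟩

theorem integrable_duhamelDensity (hu : ContDiff ℝ (⊤ : ℕ∞) u) (hc : HasCompactSupport u)
    {ε : ℝ} (hε : 0 < ε) (z : EuclideanSpace ℝ (Fin n) × ℝ) :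
    Integrable (duhamelDensity u ε z)
      ((volume : Measure (EuclideanSpace ℝ (Fin n))).prod (volume.restrict (Ioc 0 z.2))) := by
  have e : (volume : Measure (EuclideanSpace ℝ (Fin n))).prod (volume.restrict (Ioc 0 z.2)) =
      volume.restrict (univ ×ˢ Ioc 0 z.2) := by
    rw [Measure.volume_eq_prod, ← Measure.prod_restrict, Measure.restrict_univ]
  rw [e]
  have h : IntegrableOn (duhamelDensity u ε z) ((Prod.fst '' tsupport u) ×ˢ Icc 0 z.2) := by
    refine ContinuousOn.integrableOn_compact ((hc.isCompact.image continuous_fst).prod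
      isCompact_Icc) ((continuousOn_duhamelDensity hu hε z).mono ?_)
    exact prod_mono (subset_univ _) Icc_subset_Iic_self
  have h2 : IntegrableOn (duhamelDensity u ε z) (univ ×ˢ Icc 0 z.2) := by
    refine h.of_forall_sdiff_eq_zero (MeasurableSet.univ.prod measurableSet_Icc) fun w hw => ?_
    have hw1 : w ∉ tsupport u := fun h => hw.2 ⟨⟨w, h, rfl⟩, hw.1.2⟩
    have hw2 : fderiv ℝ u w = 0 := by
      by_contra hne
      exact hw1 (tsupport_fderiv_subset ℝ (subset_tsupport _ hne))
    simp [duhamelDensity, pdt, hw2, image_eq_zero_of_notMem_tsupport hw1]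
  exact h2.mono_set (prod_mono subset_rfl Ioc_subset_Icc_self)

theorem integral_duhamelDensity_lapP (hu : ContDiff ℝ (⊤ : ℕ∞) u) (hc : HasCompactSupport u)
    {ε t s : ℝ} (hε : 0 < ε) (hs : s ≤ t) (x : EuclideanSpace ℝ (Fin n)) :
    ∫ y, duhamelDensity (lapP u) ε (x, t) (y, s) =
      ∫ y, heatKerDt n (‖x - y‖ ^ 2) (t - s + ε) * (pdt u (y, s) - lapP u (y, s)) := by
  have hτ : 0 < t - s + ε := by linarith
  have hl := contDiff_lapP hu
  have hlc := hasCompactSupport_lapP hc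
  simp only [duhamelDensity, mul_sub]
  rw [integral_sub (integrable_mul_section (continuous_heatKer_norm_sub x)
      (contDiff_pdt hl).continuous (hasCompactSupport_pdt hlc) s)
      (integrable_mul_section (continuous_heatKerDt_norm_sub x) hl.continuous hlc s),
    integral_sub (integrable_mul_section (continuous_heatKerDt_norm_sub x)
      (contDiff_pdt hu).continuous (hasCompactSupport_pdt hc) s)
      (integrable_mul_section (continuous_heatKerDt_norm_sub x) hl.continuous hlc s),
    pdt_lapP hu, integral_heatKer_mul_lapP (contDiff_pdt hu) (hasCompactSupport_pdt hc) hτ]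

/-- Duhamel's formula for the mollified Laplacian of `u`. -/
theorem integral_heatKer_mul_lapP_eq_integral_singKer (hu : ContDiff ℝ (⊤ : ℕ∞) u)
    (hc : HasCompactSupport u) (h0 : ∀ x, u (x, 0) = 0) {ε t : ℝ} (hε : 0 < ε)
    (ht : t ∈ Ioo 0 1) (x : EuclideanSpace ℝ (Fin n)) :
    ∫ y, heatKer n (‖x - y‖ ^ 2) ε * lapP u (y, t) =
      ∫ w, singKer ε (x, t) w *
        (univ ×ˢ Ico 0 1).indicator (fun z => pdt u z - lapP u z) w := by
  have hl := contDiff_lapP hu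
  have hlc := hasCompactSupport_lapP hc
  set f : EuclideanSpace ℝ (Fin n) × ℝ → ℝ := fun z => pdt u z - lapP u z with hf
  have hS : MeasurableSet ((univ : Set (EuclideanSpace ℝ (Fin n))) ×ˢ Ico (0 : ℝ) 1) :=
    MeasurableSet.univ.prod measurableSet_Ico
  have hfc : Continuous f := (contDiff_pdt hu).continuous.sub hl.continuous
  have hfi : Integrable f := hfc.integrable_of_hasCompactSupport
    ((hasCompactSupport_pdt hc).sub hlc)
  have hKi : Integrable (fun w => singKer ε (x, t) w * (univ ×ˢ Ico 0 1).indicator f w)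
      ((volume : Measure (EuclideanSpace ℝ (Fin n))).prod volume) := by
    refine (hfi.indicator hS).bdd_mul
      ((measurable_singKer ε).comp measurable_prodMk_left).aestronglyMeasurable
      (Filter.Eventually.of_forall fun w => abs_singKer_le hε (x, t) w)
  rw [Measure.volume_eq_prod, integral_prod_symm _ hKi]
  calc _ = ∫ y, ∫ s in Ioc 0 t, duhamelDensity (lapP u) ε (x, t) (y, s) := by
        simp_rw [← intervalIntegral.integral_of_le ht.1.le,
          intervalIntegral_duhamelDensity hl (lapP_eq_zero h0 hu) hε ht.1.le]
    _ = ∫ s in Ioc 0 t, ∫ y, duhamelDensity (lapP u) ε (x, t) (y, s) :=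
        integral_integral_swap (integrable_duhamelDensity hl hlc hε (x, t))
    _ = ∫ s in Ioc 0 t, ∫ y, heatKerDt n (‖x - y‖ ^ 2) (t - s + ε) * f (y, s) :=
        setIntegral_congr_fun measurableSet_Ioc fun s hs =>
          integral_duhamelDensity_lapP hu hc hε hs.2 x
    _ = ∫ s in Ico 0 t, ∫ y, heatKerDt n (‖x - y‖ ^ 2) (t - s + ε) * f (y, s) := by
        rw [integral_Ico_eq_integral_Ioo, integral_Ioc_eq_integral_Ioo]
    _ = _ := by
        rw [← integral_indicator measurableSet_Ico]
        congr 1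
        ext s
        by_cases hs : s ∈ Ico 0 t
        · rw [indicator_of_mem hs]
          congr 1
          ext y
          rw [indicator_of_mem (show (y, s) ∈ univ ×ˢ Ico 0 1 from
            ⟨mem_univ _, hs.1, hs.2.trans ht.2⟩)]
          simp [singKer, hs.2]
        · rw [indicator_of_notMem hs, eq_comm]
          refine integral_eq_zero_of_ae (Filter.Eventually.of_forall fun y => ?_)
          by_cases h : s < t
          · have h' : s < 0 := by
              by_contra h1
              exact hs ⟨not_lt.1 h1, h⟩
            simp [indicator, h'.not_ge]
          · simp [singKer, h]

end DuhamelFormula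

section Conclusion

open Filter Topology

variable {n : ℕ}

theorem tendsto_norm_pow_mul_heatKer :
    Tendsto (fun x : EuclideanSpace ℝ (Fin n) =>
      ‖x‖ ^ Module.finrank ℝ (EuclideanSpace ℝ (Fin n)) * heatKer n (‖x‖ ^ 2) 1)
      (Bornology.cobounded _) (𝓝 0) := by
  rw [finrank_euclideanSpace_fin]
  have h := ((tendsto_rpow_abs_mul_exp_neg_mul_sq_cocompact (a := 1 / 4) (by norm_num) n).mono_left
    atTop_le_cocompact).comp (tendsto_norm_cobounded_atTop (E := EuclideanSpace ℝ (Fin n)))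
  have h2 := h.const_mul ((4 * Real.pi * 1) ^ (-(n / 2 : ℝ)))
  rw [mul_zero] at h2
  refine h2.congr fun x => ?_
  simp only [Function.comp_apply, abs_norm, Real.rpow_natCast, heatKer]
  rw [show -(1 / 4) * ‖x‖ ^ 2 = -‖x‖ ^ 2 / (4 * 1) by ring]
  ring

theorem pow_mul_heatKer_mul {c : ℝ} (hc : 0 < c) (q : ℝ) :
    c ^ n * heatKer n (c ^ 2 * q) 1 = heatKer n q (1 / c ^ 2) := by
  have hpi := Real.pi_pos
  have h1 : ((c ^ 2)⁻¹ : ℝ) ^ (-(n / 2 : ℝ)) = c ^ n := by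
    rw [Real.rpow_neg (by positivity), Real.inv_rpow (by positivity), inv_inv,
      ← Real.rpow_natCast c 2, ← Real.rpow_mul hc.le, ← Real.rpow_natCast c n]
    congr 1
    push_cast
    ring
  unfold heatKer
  rw [mul_one, one_div, Real.mul_rpow (x := 4 * Real.pi) (by positivity) (by positivity), h1,
    show -(c ^ 2 * q) / (4 * 1) = -q / (4 * (c ^ 2)⁻¹) by field_simp]
  ring

/-- The heat kernel is an approximate identity. -/
theorem tendsto_integral_heatKer_mul {g : EuclideanSpace ℝ (Fin n) → ℝ} (hg : Integrable g)
    (hgc : Continuous g) (x : EuclideanSpace ℝ (Fin n)) :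
    Tendsto (fun c : ℝ => ∫ y, heatKer n (‖x - y‖ ^ 2) (1 / c ^ 2) * g y) atTop (𝓝 (g x)) := by
  have h1 : ∫ x : EuclideanSpace ℝ (Fin n), heatKer n (‖x‖ ^ 2) 1 = 1 := by
    simpa only [finrank_euclideanSpace_fin] using
      integral_heatKer (V := EuclideanSpace ℝ (Fin n)) one_pos
  have h := tendsto_integral_comp_smul_smul_of_integrable'
    (fun x => (heatKer_pos (d := n) (q := ‖x‖ ^ 2) one_pos).le) h1
    tendsto_norm_pow_mul_heatKer hg (hgc.continuousAt (x := x))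
  refine h.congr' ?_
  filter_upwards [eventually_gt_atTop 0] with c hc
  simp only [finrank_euclideanSpace_fin, norm_smul, mul_pow, Real.norm_eq_abs, sq_abs,
    pow_mul_heatKer_mul hc, smul_eq_mul]

/-- A priori `Lᵖ` bound for the Laplacian, `1 < p < 2`, by weak type interpolation. -/
theorem exists_lintegral_lapP_rpow_le (hn : 1 ≤ n) {p : ℝ} (hp₁ : 1 < p) (hp₂ : p < 2) :
    ∃ C : ℝ≥0∞, C ≠ ∞ ∧ ∀ u : EuclideanSpace ℝ (Fin n) × ℝ → ℝ,
      ContDiff ℝ (⊤ : ℕ∞) u → HasCompactSupport u → (∀ x, u (x, 0) = 0) →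
        ∫⁻ z in univ ×ˢ Ioo 0 1, ENNReal.ofReal (|lapP u z| ^ p) ≤
          C * ∫⁻ z in univ ×ˢ Ioo 0 1, ENNReal.ofReal (|pdt u z - lapP u z| ^ p) := by
  obtain ⟨C, hC, h⟩ := exists_lintegral_singKer_rpow_le hn hp₁ hp₂
  refine ⟨C, hC, fun u hu hc h0 => ?_⟩
  have hl := contDiff_lapP hu
  have hlc := hasCompactSupport_lapP hc
  have hS : MeasurableSet ((univ : Set (EuclideanSpace ℝ (Fin n))) ×ˢ Ico (0 : ℝ) 1) :=
    MeasurableSet.univ.prod measurableSet_Ico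
  have hS' : MeasurableSet ((univ : Set (EuclideanSpace ℝ (Fin n))) ×ˢ Ioo (0 : ℝ) 1) :=
    MeasurableSet.univ.prod measurableSet_Ioo
  set f : EuclideanSpace ℝ (Fin n) × ℝ → ℝ := fun z => pdt u z - lapP u z with hf
  have hfc : Continuous f := (contDiff_pdt hu).continuous.sub hl.continuous
  set T : ℝ → EuclideanSpace ℝ (Fin n) × ℝ → ℝ := fun ε z =>
    ∫ w, singKer ε z w * (univ ×ˢ Ico 0 1).indicator f w with hT
  have mT : ∀ ε, Measurable (T ε) := fun ε => by
    have : Measurable fun q : (EuclideanSpace ℝ (Fin n) × ℝ) × (EuclideanSpace ℝ (Fin n) × ℝ) =>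
        singKer ε q.1 q.2 * (univ ×ˢ Ico 0 1).indicator f q.2 :=
      (measurable_singKer ε).mul ((hfc.measurable.indicator hS).comp measurable_snd)
    exact this.stronglyMeasurable.integral_prod_right'.measurable
  have hr : (volume : Measure (EuclideanSpace ℝ (Fin n) × ℝ)).restrict (univ ×ˢ Ico 0 1) =
      volume.restrict (univ ×ˢ Ioo 0 1) := by
    rw [Measure.volume_eq_prod, ← Measure.prod_restrict, ← Measure.prod_restrict,
      restrict_Ioo_eq_restrict_Ico]
  have hlim : ∀ z ∈ (univ : Set (EuclideanSpace ℝ (Fin n))) ×ˢ Ioo (0 : ℝ) 1,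
      Tendsto (fun k : ℕ => T (1 / ((k : ℝ) + 1) ^ 2) z) atTop (𝓝 (lapP u z)) := by
    rintro ⟨x, t⟩ ⟨-, ht⟩
    have hi : Integrable fun y => lapP u (y, t) := by
      simpa using integrable_mul_section (continuous_const (y := (1 : ℝ))) hl.continuous hlc t
    have h1 := (tendsto_integral_heatKer_mul hi (hl.continuous.comp (by fun_prop)) x).comp
      (tendsto_natCast_atTop_atTop.atTop_add (tendsto_const_nhds (x := (1 : ℝ))))
    refine h1.congr fun k => ?_
    exact integral_heatKer_mul_lapP_eq_integral_singKer hu hc h0 (by positivity) ht x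
  calc ∫⁻ z in univ ×ˢ Ioo 0 1, ENNReal.ofReal (|lapP u z| ^ p)
      = ∫⁻ z in univ ×ˢ Ioo 0 1,
          liminf (fun k : ℕ => ENNReal.ofReal (|T (1 / ((k : ℝ) + 1) ^ 2) z| ^ p)) atTop := by
        refine setLIntegral_congr_fun hS' fun z hz => Eq.symm (Tendsto.liminf_eq ?_)
        exact ENNReal.tendsto_ofReal ((hlim z hz).abs.rpow_const (Or.inr (by linarith)))
    _ ≤ liminf (fun k : ℕ => ∫⁻ z in univ ×ˢ Ioo 0 1,
          ENNReal.ofReal (|T (1 / ((k : ℝ) + 1) ^ 2) z| ^ p)) atTop :=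
        lintegral_liminf_le fun k => by
          have := mT (1 / ((k : ℝ) + 1) ^ 2)
          fun_prop
    _ ≤ liminf (fun _ : ℕ => C * ∫⁻ z in univ ×ˢ Ico 0 1, ENNReal.ofReal (|f z| ^ p)) atTop := by
        refine liminf_le_liminf (Eventually.of_forall fun k => ?_)
        exact (setLIntegral_le_lintegral _ _).trans
          (h f hfc ((hasCompactSupport_pdt hc).sub hlc) _ (by positivity))
    _ = _ := by rw [liminf_const, hr]

end Conclusion

/-- Duality step for the parabolic estimate: for `1 < p < 2` there is `C = C(n,p) > 0`
such that for every smooth compactly supported `u` on `ℝⁿ × ℝ` with `u(·,0) = 0`, setting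
`f := ∂_t u − Δu`, one has `‖∂_t u‖_{L^p(ℝⁿ×(0,1))} ≤ C ‖f‖_{L^p(ℝⁿ×(0,1))}` and
consequently `‖Δu‖_{L^p(ℝⁿ×(0,1))} ≤ (1+C) ‖f‖_{L^p(ℝⁿ×(0,1))}`. -/
theorem parabolic_duality_step (n : ℕ) (hn : 1 ≤ n) (p : ℝ) (hp₁ : 1 < p) (hp₂ : p < 2) :
    ∃ C : ℝ, 0 < C ∧
      ∀ u : EuclideanSpace ℝ (Fin n) × ℝ → ℝ,
        ContDiff ℝ (⊤ : ℕ∞) u → HasCompactSupport u →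
        (∀ x : EuclideanSpace ℝ (Fin n), u (x, 0) = 0) →
        (∫⁻ z in (univ : Set (EuclideanSpace ℝ (Fin n))) ×ˢ Ioo (0:ℝ) 1,
              ENNReal.ofReal (|pdt u z| ^ p)) ^ (1 / p) ≤
            ENNReal.ofReal C *
              (∫⁻ z in (univ : Set (EuclideanSpace ℝ (Fin n))) ×ˢ Ioo (0:ℝ) 1,
                ENNReal.ofReal (|pdt u z - lapP u z| ^ p)) ^ (1 / p) ∧
        (∫⁻ z in (univ : Set (EuclideanSpace ℝ (Fin n))) ×ˢ Ioo (0:ℝ) 1,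
              ENNReal.ofReal (|lapP u z| ^ p)) ^ (1 / p) ≤
            ENNReal.ofReal (1 + C) *
              (∫⁻ z in (univ : Set (EuclideanSpace ℝ (Fin n))) ×ˢ Ioo (0:ℝ) 1,
                ENNReal.ofReal (|pdt u z - lapP u z| ^ p)) ^ (1 / p) := by
  have hp₀ : 0 < p := by linarith
  obtain ⟨K, hK, h⟩ := exists_lintegral_lapP_rpow_le hn hp₁ hp₂
  have hK' : K ^ (1 / p) ≠ ∞ := ENNReal.rpow_ne_top_of_nonneg (by positivity) hK
  have hof : ENNReal.ofReal (1 + (K ^ (1 / p)).toReal) = 1 + K ^ (1 / p) := by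
    rw [ENNReal.ofReal_add zero_le_one ENNReal.toReal_nonneg, ENNReal.ofReal_one,
      ENNReal.ofReal_toReal hK']
  refine ⟨1 + (K ^ (1 / p)).toReal, by positivity, fun u hu hc h0 => ?_⟩
  have hL : (∫⁻ z in (univ : Set (EuclideanSpace ℝ (Fin n))) ×ˢ Ioo (0:ℝ) 1,
      ENNReal.ofReal (|lapP u z| ^ p)) ^ (1 / p) ≤ K ^ (1 / p) *
        (∫⁻ z in (univ : Set (EuclideanSpace ℝ (Fin n))) ×ˢ Ioo (0:ℝ) 1,
          ENNReal.ofReal (|pdt u z - lapP u z| ^ p)) ^ (1 / p) := by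
    rw [← ENNReal.mul_rpow_of_nonneg _ _ (by positivity)]
    exact ENNReal.rpow_le_rpow (h u hu hc h0) (by positivity)
  have mT := (contDiff_pdt hu).continuous.measurable
  have mL := (contDiff_lapP hu).continuous.measurable
  have hof_rpow : ∀ r : ℝ, ENNReal.ofReal |r| ^ p = ENNReal.ofReal (|r| ^ p) := fun r =>
    ENNReal.ofReal_rpow_of_nonneg (abs_nonneg r) hp₀.le
  refine ⟨?_, hL.trans ?_⟩
  · have hM := ENNReal.lintegral_Lp_add_le
      (μ := volume.restrict ((univ : Set (EuclideanSpace ℝ (Fin n))) ×ˢ Ioo (0:ℝ) 1))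
      (f := fun z => ENNReal.ofReal |pdt u z - lapP u z|)
      (g := fun z => ENNReal.ofReal |lapP u z|) (by fun_prop) (by fun_prop) hp₁.le
    simp only [Pi.add_apply, hof_rpow] at hM
    rw [hof, add_mul, one_mul]
    refine le_trans (ENNReal.rpow_le_rpow (lintegral_mono fun z => ?_) (by positivity))
      (hM.trans (add_le_add le_rfl hL))
    dsimp only
    rw [← hof_rpow, ← ENNReal.ofReal_add (abs_nonneg _) (abs_nonneg _)]
    refine ENNReal.rpow_le_rpow (ENNReal.ofReal_le_ofReal ?_) hp₀.le
    simpa using abs_add_le (pdt u z - lapP u z) (lapP u z)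
  · refine mul_le_mul' ?_ le_rfl
    rw [ENNReal.ofReal_add zero_le_one (by positivity), hof]
    exact le_add_left le_add_self
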